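/- Let K be a field of characteristic zero and q ∈ K a nonzero element transcendental over ℚ. Let (I|J, I'|J') be a cortege for m,n with |I| ≥ |I'|, and let (I°, I•, J°, J•) be its refinement. The following statements are equivalent: (i) there exists c ∈ ℤ such that [I|J]·[I'|J'] = q^c [I'|J']·[I|J] holds for every associative unital K-algebra A and every m×n q-matrix x with entries in A; (ii) the cortege (I|J, I'|J') admits exactly one feasible matching; (iii) I and I' are weakly separated, J and J' are weakly separated, and either (a) |I•|·|J•| = 0, or (b) I• and J• are both nonempty and either (I° < I• and J• < J°) or (I• < I° and J° < J•). -/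

import Mathlib

/-- Number of inversions of a permutation of `Fin k`. -/
def permInversions {k : ℕ} (σ : Equiv.Perm (Fin k)) : ℕ :=
  (Finset.univ.filter (fun p : Fin k × Fin k => p.1 < p.2 ∧ σ p.2 < σ p.1)).card

/-- The quantum minor `[I|J]_q` of a matrix `x` (indexed by `ℕ`, rows/columns `1,…`),
with row set `I` and column set `J` (both listed in increasing order). -/
noncomputable def qMinor {K : Type} [Field K] {A : Type} [Ring A] [Algebra K A]
    (q : K) (x : ℕ → ℕ → A) (I J : Finset ℕ) : A :=
  if h : I.card = J.card then
    ∑ σ : Equiv.Perm (Fin I.card),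
      ((-q) ^ permInversions σ) •
        (List.ofFn (fun d : Fin I.card =>
          x (I.orderEmbOfFin rfl d) (J.orderEmbOfFin h.symm (σ d)))).prod
  else 0

/-- The flag quantum minor `[J]_q := [{1,…,|J|} | J]_q`. -/
noncomputable def flagMinor {K : Type} [Field K] {A : Type} [Ring A] [Algebra K A]
    (q : K) (x : ℕ → ℕ → A) (J : Finset ℕ) : A :=
  qMinor q x (Finset.Icc 1 J.card) J

/-- Manin's relations: `x` is an `m × n` `q`-matrix. -/
def IsQMatrix {K : Type} [Field K] {A : Type} [Ring A] [Algebra K A]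
    (q : K) (m n : ℕ) (x : ℕ → ℕ → A) : Prop :=
  (∀ i j k, 1 ≤ i → i ≤ m → 1 ≤ j → j < k → k ≤ n →
    x i j * x i k = q • (x i k * x i j)) ∧
  (∀ i l j, 1 ≤ i → i < l → l ≤ m → 1 ≤ j → j ≤ n →
    x i j * x l j = q • (x l j * x i j)) ∧
  (∀ i l j k, 1 ≤ i → i < l → l ≤ m → 1 ≤ j → j < k → k ≤ n →
    x i k * x l j = x l j * x i k) ∧
  (∀ i l j k, 1 ≤ i → i < l → l ≤ m → 1 ≤ j → j < k → k ≤ n →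
    x i j * x l k - x l k * x i j = (q - q⁻¹) • (x i k * x l j))

/-- `X < Y` elementwise: every element of `X` is smaller than every element of `Y`. -/
def finsetLT (X Y : Finset ℕ) : Prop := ∀ a ∈ X, ∀ b ∈ Y, a < b

/-- One-sided weak separation: `|I| ≥ |J|` and `J - I` has a partition `J₁ ∪ J₂`
with `J₁ < I - J < J₂`. -/
def WShalf (I J : Finset ℕ) : Prop :=
  J.card ≤ I.card ∧ ∃ J₁ J₂ : Finset ℕ, Disjoint J₁ J₂ ∧ J₁ ∪ J₂ = J \ I ∧
    finsetLT J₁ (I \ J) ∧ finsetLT (I \ J) J₂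

/-- `I` and `J` are weakly separated. -/
def WeaklySeparated (I J : Finset ℕ) : Prop := WShalf I J ∨ WShalf J I

/-- `Inv(A,B)`: the number of pairs `(a,b) ∈ A × B` with `a > b`. -/
def invPairs (A B : Finset ℕ) : ℕ := ((A ×ˢ B).filter (fun p => p.2 < p.1)).card

/-- A cortege `(I|J, I'|J')` for `m,n`. -/
structure Cortege (m n : ℕ) where
  I : Finset ℕ
  J : Finset ℕ
  I' : Finset ℕ
  J' : Finset ℕ
  hIm : I ⊆ Finset.Icc 1 m
  hI'm : I' ⊆ Finset.Icc 1 m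
  hJn : J ⊆ Finset.Icc 1 n
  hJ'n : J' ⊆ Finset.Icc 1 n
  hIJ : I.card = J.card
  hI'J' : I'.card = J'.card

/-- Elements of the ground set `Y^r ⊔ Y^c`: `Sum.inl i` is a row index, `Sum.inr j`
a column index. -/
abbrev Elt := ℕ ⊕ ℕ

/-- The linear order on `Y^r ⊔ Y^c`: rows in increasing order first, then columns
in decreasing order. -/
def cLT : Elt → Elt → Prop
  | Sum.inl i, Sum.inl i' => i < i'
  | Sum.inl _, Sum.inr _ => True
  | Sum.inr _, Sum.inl _ => False
  | Sum.inr j, Sum.inr j' => j' < j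

instance : DecidableRel cLT := fun a b =>
  match a, b with
  | Sum.inl i, Sum.inl i' => inferInstanceAs (Decidable (i < i'))
  | Sum.inl _, Sum.inr _ => inferInstanceAs (Decidable True)
  | Sum.inr _, Sum.inl _ => inferInstanceAs (Decidable False)
  | Sum.inr j, Sum.inr j' => inferInstanceAs (Decidable (j' < j))

/-- Two elements lie on the same side (both rows or both columns). -/
abbrev sameSide (a b : Elt) : Prop := a.isLeft = b.isLeft

/-- The underlying numerical index of an element. -/
abbrev eVal : Elt → ℕ := Sum.elim id id

/-- The numerically smaller member of a couple (used for couples lying in one side). -/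
def numMin (p : Elt × Elt) : Elt := if eVal p.1 ≤ eVal p.2 then p.1 else p.2

namespace Cortege
variable {m n : ℕ}

/-- White elements of the refinement: `I° = I - I'` (rows) and `J° = J - J'` (columns). -/
def whites (S : Cortege m n) : Finset Elt :=
  (S.I \ S.I').image Sum.inl ∪ (S.J \ S.J').image Sum.inr

/-- Black elements of the refinement: `I• = I' - I` (rows) and `J• = J' - J` (columns). -/
def blacks (S : Cortege m n) : Finset Elt :=
  (S.I' \ S.I).image Sum.inl ∪ (S.J' \ S.J).image Sum.inr

/-- The ground set `Y^r ⊔ Y^c` of a cortege. -/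
def ground (S : Cortege m n) : Finset Elt := S.whites ∪ S.blacks

end Cortege

/-- `M` is a feasible matching for the cortege `S`.  Couples are stored as pairs
`(a, b)` with `a` preceding `b` in the linear order `cLT`. -/
def IsFeasible {m n : ℕ} (S : Cortege m n) (M : Finset (Elt × Elt)) : Prop :=
  (∀ p ∈ M, p.1 ∈ S.ground ∧ p.2 ∈ S.ground ∧ cLT p.1 p.2) ∧
  (∀ y ∈ S.ground, ∃! p, p ∈ M ∧ (p.1 = y ∨ p.2 = y)) ∧
  (∀ p ∈ M, (sameSide p.1 p.2 → (p.1 ∈ S.whites ↔ p.2 ∈ S.blacks)) ∧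
            (¬ sameSide p.1 p.2 → (p.1 ∈ S.whites ↔ p.2 ∈ S.whites))) ∧
  (∀ p ∈ M, ∀ p' ∈ M, ¬ (cLT p.1 p'.1 ∧ cLT p'.1 p.2 ∧ cLT p.2 p'.2))

/-- The set of elements covered by a set of couples. -/
def coveredBy (Φ : Finset (Elt × Elt)) : Finset Elt :=
  Φ.image Prod.fst ∪ Φ.image Prod.snd

/-- `T` is obtained from `S` by the index exchange operation using the couples `Φ`:
the intersections and unions of the row (resp. column) sets are unchanged, and
the white/black color is flipped exactly on the elements covered by `Φ`. -/
def IsExchange {m n : ℕ} (S T : Cortege m n) (Φ : Finset (Elt × Elt)) : Prop :=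
  S.I ∩ S.I' = T.I ∩ T.I' ∧ S.J ∩ S.J' = T.J ∩ T.J' ∧
  S.I ∪ S.I' = T.I ∪ T.I' ∧ S.J ∪ S.J' = T.J ∪ T.J' ∧
  ∀ a ∈ S.ground,
    (a ∈ coveredBy Φ → (a ∈ S.whites ↔ a ∈ T.blacks)) ∧
    (a ∉ coveredBy Φ → (a ∈ S.whites ↔ a ∈ T.whites))

/-- The couples of `M` on which the white/black colorings of `S` and `T` differ. -/
def differSet {m n : ℕ} (S T : Cortege m n) (M : Finset (Elt × Elt)) :
    Finset (Elt × Elt) :=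
  M.filter (fun p =>
    ¬ (p.1 ∈ S.whites ↔ p.1 ∈ T.whites) ∨ ¬ (p.2 ∈ S.whites ↔ p.2 ∈ T.whites))

/-- `ζ°(S;Φ)`: the number of couples of `Φ` lying within one side whose numerically
smaller element is white. -/
def zetaWhite {m n : ℕ} (S : Cortege m n) (Φ : Finset (Elt × Elt)) : ℕ :=
  (Φ.filter (fun p => sameSide p.1 p.2 ∧ numMin p ∈ S.whites)).card

/-- `ζ•(S;Φ)`: the number of couples of `Φ` lying within one side whose numerically
smaller element is black. -/
def zetaBlack {m n : ℕ} (S : Cortege m n) (Φ : Finset (Elt × Elt)) : ℕ :=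
  (Φ.filter (fun p => sameSide p.1 p.2 ∧ numMin p ∈ S.blacks)).card

/-- Configurations for an (indexed) family of corteges: pairs of a member of the family
and a feasible matching for it. -/
def Config {m n : ℕ} {ι : Type} (F : ι → Cortege m n) : Type :=
  {p : ι × Finset (Elt × Elt) // IsFeasible (F p.1) p.2}

/-- The quadruple `(F, G, α, β)` is `q`-balanced. -/
def QBalanced {m n : ℕ} {ι κ : Type} (F : ι → Cortege m n) (G : κ → Cortege m n)
    (α : ι → ℤ) (β : κ → ℤ) : Prop :=
  ∃ γ : Config F ≃ Config G, ∀ c : Config F,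
    ((γ c).1.2 = c.1.2) ∧
    IsExchange (F c.1.1) (G (γ c).1.1) (differSet (F c.1.1) (G (γ c).1.1) c.1.2) ∧
    β (γ c).1.1 - α c.1.1 =
      (zetaWhite (F c.1.1) (differSet (F c.1.1) (G (γ c).1.1) c.1.2) : ℤ) -
      (zetaBlack (F c.1.1) (differSet (F c.1.1) (G (γ c).1.1) c.1.2) : ℤ)

/-- The two families `F`, `G` are (jointly) homogeneous. -/
def Homogeneous {m n : ℕ} {ι κ : Type} (F : ι → Cortege m n) (G : κ → Cortege m n) : Prop :=
  ∀ S T : Cortege m n,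
    ((∃ i, F i = S) ∨ (∃ k, G k = S)) → ((∃ i, F i = T) ∨ (∃ k, G k = T)) →
    S.I ∪ S.I' = T.I ∪ T.I' ∧ S.I ∩ S.I' = T.I ∩ T.I' ∧
    S.J ∪ S.J' = T.J ∪ T.J' ∧ S.J ∩ S.J' = T.J ∩ T.J'

namespace QuasiCommute

open scoped TensorProduct

section RowMinor

variable {K : Type} [Field K] {A : Type} [Ring A] [Algebra K A]

/-- The entries of the row `ρ` satisfy the relations of a one-row `q`-matrix. -/
def RowSelf (q : K) (ρ : ℕ → A) : Prop :=
  ∀ j k, j < k → ρ j * ρ k = q • (ρ k * ρ j)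

/-- The relations of a `q`-matrix between the entries of a row `ρ` and of a lower row `σ`. -/
structure RowRel (q : K) (ρ σ : ℕ → A) : Prop where
  col : ∀ j, ρ j * σ j = q • (σ j * ρ j)
  anti : ∀ j k, j < k → ρ k * σ j = σ j * ρ k
  diag : ∀ j k, j < k → ρ j * σ k = σ k * ρ j + (q - q⁻¹) • (ρ k * σ j)

/-- A list of rows forms a `q`-matrix. -/
def RowsQ (q : K) (L : List (ℕ → A)) : Prop :=
  (∀ ρ ∈ L, RowSelf q ρ) ∧ L.Pairwise (RowRel q)

/-- The quantum minor of a list of rows with column set `J`, expanded along the first row. -/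
noncomputable def rowMinor (q : K) : List (ℕ → A) → Finset ℕ → A
  | [], J => if J = ∅ then 1 else 0
  | ρ :: L, J =>
      ∑ j ∈ J, ((-q) ^ (J.filter (· < j)).card) • (ρ j * rowMinor q L (J.erase j))

theorem rowMinor_eq_zero_of_length_ne (q : K) (L : List (ℕ → A)) (J : Finset ℕ)
    (h : L.length ≠ J.card) : rowMinor q L J = 0 := by
  induction L generalizing J with
  | nil =>
    have : J ≠ ∅ := by rintro rfl; simp at h
    simp [rowMinor, this]
  | cons ρ L ih =>
    refine Finset.sum_eq_zero fun j hj => ?_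
    rw [ih, mul_zero, smul_zero]
    rw [Finset.card_erase_of_mem hj]
    have := Finset.card_pos.2 ⟨j, hj⟩
    simp only [List.length_cons] at h
    omega

theorem rowMinor_add (q : K) (p s : List (ℕ → A)) (ρ σ : ℕ → A) (J : Finset ℕ) :
    rowMinor q (p ++ (ρ + σ) :: s) J =
      rowMinor q (p ++ ρ :: s) J + rowMinor q (p ++ σ :: s) J := by
  induction p generalizing J with
  | nil => simp [rowMinor, add_mul, Finset.sum_add_distrib]
  | cons τ p ih => simp [rowMinor, ih, mul_add, Finset.sum_add_distrib]

theorem card_filter_lt_erase (J : Finset ℕ) {j k : ℕ} (h : j ∈ J) (hjk : j < k) :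
    (J.filter (· < k)).card = ((J.erase j).filter (· < k)).card + 1 := by
  rw [Finset.filter_erase, Finset.card_erase_add_one]
  simp [h, hjk]

theorem card_filter_lt_erase_of_le (J : Finset ℕ) {j k : ℕ} (hjk : k ≤ j) :
    ((J.erase j).filter (· < k)).card = (J.filter (· < k)).card := by
  rw [Finset.filter_erase, Finset.erase_eq_of_notMem]
  simp [hjk]

theorem rowMinor_eq_zero_of_repeat (q : K) (p s : List (ℕ → A)) {ρ : ℕ → A}
    (h : RowSelf q ρ) (J : Finset ℕ) : rowMinor q (p ++ ρ :: ρ :: s) J = 0 := by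
  induction p generalizing J with
  | cons τ p ih => simp [rowMinor, ih]
  | nil =>
    simp only [List.nil_append, rowMinor, Finset.mul_sum, Finset.smul_sum, Finset.sum_sigma']
    refine Finset.sum_involution (fun a _ => ⟨a.2, a.1⟩) ?_ ?_ ?_ ?_
    · rintro ⟨j, k⟩ hjk
      simp only [Finset.mem_sigma, Finset.mem_erase] at hjk
      obtain ⟨hj, hkj, hk⟩ := hjk
      have key : ∀ j k : ℕ, j ∈ J → k ∈ J → j < k →
          (-q) ^ (J.filter (· < j)).card • (ρ j *
            (-q) ^ ((J.erase j).filter (· < k)).card • (ρ k * rowMinor q s ((J.erase j).erase k)))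
          + (-q) ^ (J.filter (· < k)).card • (ρ k *
            (-q) ^ ((J.erase k).filter (· < j)).card •
              (ρ j * rowMinor q s ((J.erase k).erase j))) = 0 := by
        intro j k hj hk hlt
        rw [card_filter_lt_erase J hj hlt, card_filter_lt_erase_of_le J hlt.le,
          Finset.erase_right_comm (a := k)]
        simp only [mul_smul_comm, smul_smul, ← mul_assoc, h j k hlt, smul_mul_assoc]
        rw [← add_smul]
        convert zero_smul K _ using 2
        ring
      rcases lt_or_gt_of_ne hkj with hlt | hlt
      · rw [add_comm]; exact key k j hk hj hlt
      · exact key j k hj hk hlt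
    · rintro ⟨j, k⟩ hjk _ heq
      simp only [Finset.mem_sigma, Finset.mem_erase] at hjk
      simp only [Sigma.mk.injEq, heq_eq_eq] at heq
      exact hjk.2.1 heq.1
    · rintro ⟨j, k⟩ hjk
      simp only [Finset.mem_sigma, Finset.mem_erase] at hjk ⊢
      exact ⟨hjk.2.2, fun h => hjk.2.1 h.symm, hjk.1⟩
    · rintro ⟨j, k⟩ hjk
      rfl

theorem commute_rowMinor {q : K} {L : List (ℕ → A)} {J : Finset ℕ} {a : A}
    (h : ∀ ρ ∈ L, ∀ j ∈ J, Commute a (ρ j)) : Commute a (rowMinor q L J) := by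
  induction L generalizing J with
  | nil => unfold rowMinor; split_ifs <;> simp
  | cons ρ L ih =>
    refine Commute.sum_right _ _ _ fun j hj => Commute.smul_right ?_ _
    refine (h ρ (by simp) j hj).mul_right (ih fun σ hσ k hk => ?_)
    exact h σ (by simp [hσ]) k (Finset.mem_of_mem_erase hk)

/-- Laplace expansion along a splitting of the list of rows. -/
theorem rowMinor_append (q : K) (L M : List (ℕ → A)) (J : Finset ℕ) :
    rowMinor q (L ++ M) J = ∑ B ∈ J.powerset,
      ((-q) ^ (((J \ B) ×ˢ B).filter (fun p => p.2 < p.1)).card) •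
        (rowMinor q L (J \ B) * rowMinor q M B) := by
  induction L generalizing J with
  | nil =>
    rw [Finset.sum_eq_single J]
    · simp [rowMinor]
    · intro B hB hne
      have : ¬ J ⊆ B := fun h => hne (Finset.Subset.antisymm (Finset.mem_powerset.1 hB) h)
      simp [rowMinor, this]
    · simp
  | cons ρ L ih =>
    simp only [List.cons_append, rowMinor, ih, Finset.mul_sum, Finset.sum_mul, Finset.smul_sum,
      Finset.sum_sigma']
    refine Finset.sum_bij' (fun a _ => ⟨a.2, a.1⟩) (fun a _ => ⟨a.2, a.1⟩) ?_ ?_ ?_ ?_ ?_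
    · rintro ⟨j, B⟩ h
      simp only [Finset.mem_sigma, Finset.mem_powerset, Finset.subset_erase,
        Finset.mem_sdiff] at h ⊢
      exact ⟨h.2.1, h.1, h.2.2⟩
    · rintro ⟨B, j⟩ h
      simp only [Finset.mem_sigma, Finset.mem_powerset, Finset.subset_erase,
        Finset.mem_sdiff] at h ⊢
      exact ⟨h.2.1, h.1, h.2.2⟩
    · rintro ⟨j, B⟩ h; rfl
    · rintro ⟨j, B⟩ h; rfl
    · rintro ⟨j, B⟩ h
      simp only [Finset.mem_sigma, Finset.mem_powerset, Finset.subset_erase] at h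
      obtain ⟨hj, hB, hjB⟩ := h
      have e1 : (J.erase j) \ B = (J \ B).erase j := by
        ext k; simp only [Finset.mem_sdiff, Finset.mem_erase]; tauto
      have hj' : j ∈ J \ B := by simp [hj, hjB]
      have e2 : (J.filter (· < j)).card = ((J \ B).filter (· < j)).card
          + (B.filter (· < j)).card := by
        rw [← Finset.card_union_of_disjoint]
        · congr 1
          rw [← Finset.filter_union, Finset.sdiff_union_of_subset hB]
        · exact Finset.disjoint_filter_filter Finset.sdiff_disjoint
      have e3 : (((J \ B) ×ˢ B).filter (fun p => p.2 < p.1)).card =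
          ((((J \ B).erase j) ×ˢ B).filter (fun p => p.2 < p.1)).card +
            (B.filter (· < j)).card := by
        conv_lhs => rw [← Finset.insert_erase hj', Finset.insert_eq, Finset.union_product,
          Finset.filter_union]
        rw [Finset.card_union_of_disjoint, add_comm]
        · rw [Finset.singleton_product, Finset.filter_map, Finset.card_map]
          rfl
        · refine Finset.disjoint_filter_filter ?_
          rw [Finset.disjoint_left]
          rintro ⟨a, b⟩ hab
          simp only [Finset.mem_product, Finset.mem_singleton] at hab
          simp [hab.1]
      rw [e1, e2, e3]
      simp only [mul_smul_comm, smul_mul_assoc, smul_smul, mul_assoc, ← pow_add]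
      congr 2
      omega

end RowMinor

section Tensor

variable {K : Type} [Field K] {q : K}

/-- A quantum torus: an algebra with invertible `a`, `b` such that `a b = q b a`. -/
theorem exists_quantumTorus (hq : q ≠ 0) :
    ∃ (W : Type) (_ : Ring W) (_ : Algebra K W) (_ : Nontrivial W) (a b : Wˣ),
      (a : W) * b = q • ((b : W) * a) := by
  let a : (Module.End K (ℤ → K))ˣ :=
    ⟨LinearMap.funLeft K K (fun n : ℤ => n + 1), LinearMap.funLeft K K (fun n : ℤ => n - 1),
      by ext f n; simp [LinearMap.funLeft], by ext f n; simp [LinearMap.funLeft]⟩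
  let b : (Module.End K (ℤ → K))ˣ :=
    ⟨LinearMap.pi fun n : ℤ => (q ^ n) • LinearMap.proj n,
      LinearMap.pi fun n : ℤ => (q ^ (-n)) • LinearMap.proj n,
      by
        refine LinearMap.ext fun f => funext fun n => ?_
        simp [zpow_ne_zero n hq],
      by
        refine LinearMap.ext fun f => funext fun n => ?_
        simp [zpow_ne_zero n hq]⟩
  refine ⟨Module.End K (ℤ → K), inferInstance, inferInstance, inferInstance, a, b, ?_⟩
  refine LinearMap.ext fun f => funext fun n => ?_
  simp [a, b, LinearMap.funLeft, zpow_add₀ hq, mul_assoc, mul_comm]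

variable {A : Type} [Ring A] [Algebra K A] {W : Type} [Ring W] [Algebra K W]

/-- The row `ρ` scaled by an element of an auxiliary algebra. -/
def tens (ρ : ℕ → A) (w : W) : ℕ → A ⊗[K] W := fun j => ρ j ⊗ₜ[K] w

theorem rowMinor_tens (L : List ((ℕ → A) × W)) (J : Finset ℕ) :
    rowMinor q (L.map fun x => tens (K := K) x.1 x.2) J =
      rowMinor q (L.map Prod.fst) J ⊗ₜ[K] (L.map Prod.snd).prod := by
  induction L generalizing J with
  | nil =>
    by_cases h : J = ∅
    · simp [rowMinor, h, Algebra.TensorProduct.one_def]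
    · simp [rowMinor, h]
  | cons x L ih =>
    simp only [List.map_cons, rowMinor, ih, List.prod_cons, TensorProduct.sum_tmul, tens,
      Algebra.TensorProduct.tmul_mul_tmul, TensorProduct.smul_tmul']

theorem rowMinor_tens_one (p s : List (ℕ → A)) (ρ : ℕ → A) (u : W) (J : Finset ℕ) :
    rowMinor q (p.map (fun ρ => tens (K := K) ρ (1 : W)) ++
      tens ρ u :: s.map (fun ρ => tens ρ 1)) J =
      rowMinor q (p ++ ρ :: s) J ⊗ₜ[K] u := by
  have := rowMinor_tens (q := q)
    (p.map (fun ρ => (ρ, (1 : W))) ++ (ρ, u) :: s.map fun ρ => (ρ, (1 : W))) J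
  simpa [List.map_map, Function.comp_def] using this

theorem rowMinor_tens_two (p s : List (ℕ → A)) (ρ σ : ℕ → A) (u v : W) (J : Finset ℕ) :
    rowMinor q (p.map (fun ρ => tens (K := K) ρ (1 : W)) ++
      tens ρ u :: tens σ v :: s.map (fun ρ => tens ρ 1)) J =
      rowMinor q (p ++ ρ :: σ :: s) J ⊗ₜ[K] (u * v) := by
  have := rowMinor_tens (q := q)
    (p.map (fun ρ => (ρ, (1 : W))) ++ (ρ, u) :: (σ, v) :: s.map fun ρ => (ρ, (1 : W))) J
  simpa [List.map_map, Function.comp_def] using this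

theorem tmul_unit_injective (u : Wˣ) {x y : A} [Nontrivial W]
    (h : x ⊗ₜ[K] (u : W) = y ⊗ₜ[K] (u : W)) : x = y := by
  have h' := congrArg (· * ((1 : A) ⊗ₜ[K] ((u⁻¹ : Wˣ) : W))) h
  simp only [Algebra.TensorProduct.tmul_mul_tmul, mul_one, Units.mul_inv] at h'
  exact Algebra.TensorProduct.includeLeft_injective (S := K)
    (FaithfulSMul.algebraMap_injective K W) h'

theorem RowRel.tens {ρ σ : ℕ → A} (h : RowRel q ρ σ) {u v : W} (huv : u * v = v * u) :
    RowRel q (tens (K := K) ρ u) (tens (K := K) σ v) where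
  col j := by
    simp only [QuasiCommute.tens, Algebra.TensorProduct.tmul_mul_tmul, h.col j, huv,
      TensorProduct.smul_tmul']
  anti j k hjk := by
    simp only [QuasiCommute.tens, Algebra.TensorProduct.tmul_mul_tmul, h.anti j k hjk, huv]
  diag j k hjk := by
    simp only [QuasiCommute.tens, Algebra.TensorProduct.tmul_mul_tmul, h.diag j k hjk, huv,
      TensorProduct.add_tmul, TensorProduct.smul_tmul']

theorem RowSelf.rowRel_tens (hq : q ≠ 0) {ρ : ℕ → A} (h : RowSelf q ρ) {u v : W}
    (huv : u * v = q • (v * u)) : RowRel q (QuasiCommute.tens (K := K) ρ u)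
      (QuasiCommute.tens (K := K) ρ v) where
  col j := by
    simp only [QuasiCommute.tens, Algebra.TensorProduct.tmul_mul_tmul, huv,
      TensorProduct.tmul_smul]
  anti j k hjk := by
    simp only [QuasiCommute.tens, Algebra.TensorProduct.tmul_mul_tmul, huv, h j k hjk,
      TensorProduct.tmul_smul, TensorProduct.smul_tmul']
  diag j k hjk := by
    simp only [QuasiCommute.tens, Algebra.TensorProduct.tmul_mul_tmul, huv, h j k hjk,
      TensorProduct.tmul_smul, TensorProduct.smul_tmul', smul_smul]
    have e : q * q = 1 + (q - q⁻¹) * q := by field_simp; ring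
    rw [← TensorProduct.smul_tmul', ← TensorProduct.smul_tmul', e, add_smul, one_smul]

theorem RowSelf.tens {ρ : ℕ → A} (h : RowSelf q ρ) (u : W) :
    RowSelf q (QuasiCommute.tens (K := K) ρ u) := by
  intro j k hjk
  simp only [QuasiCommute.tens, Algebra.TensorProduct.tmul_mul_tmul, h j k hjk,
    TensorProduct.smul_tmul']

theorem RowRel.add_left {ρ ρ' σ : ℕ → A} (h : RowRel q ρ σ) (h' : RowRel q ρ' σ) :
    RowRel q (ρ + ρ') σ where
  col j := by simp only [Pi.add_apply, add_mul, mul_add, h.col j, h'.col j, smul_add]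
  anti j k hjk := by
    simp only [Pi.add_apply, add_mul, mul_add, h.anti j k hjk, h'.anti j k hjk]
  diag j k hjk := by
    simp only [Pi.add_apply, add_mul, mul_add, h.diag j k hjk, h'.diag j k hjk, smul_add]
    abel

theorem RowRel.add_right {ρ σ σ' : ℕ → A} (h : RowRel q ρ σ) (h' : RowRel q ρ σ') :
    RowRel q ρ (σ + σ') where
  col j := by simp only [Pi.add_apply, add_mul, mul_add, h.col j, h'.col j, smul_add]
  anti j k hjk := by
    simp only [Pi.add_apply, add_mul, mul_add, h.anti j k hjk, h'.anti j k hjk]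
  diag j k hjk := by
    simp only [Pi.add_apply, add_mul, mul_add, h.diag j k hjk, h'.diag j k hjk, smul_add]
    abel

theorem RowSelf.add_tens (hq : q ≠ 0) {ρ σ : ℕ → A} (hρ : RowSelf q ρ) (hσ : RowSelf q σ)
    (h : RowRel q ρ σ) {u v : W} (huv : u * v = q • (v * u)) :
    RowSelf q (QuasiCommute.tens (K := K) ρ u + QuasiCommute.tens (K := K) σ v) := by
  intro j k hjk
  simp only [QuasiCommute.tens, Pi.add_apply, add_mul, mul_add,
    Algebra.TensorProduct.tmul_mul_tmul, hρ j k hjk, hσ j k hjk, h.diag j k hjk, huv,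
    TensorProduct.tmul_smul, smul_add, ← TensorProduct.smul_tmul', TensorProduct.add_tmul,
    h.anti j k hjk, smul_smul]
  have e : (q * (q - q⁻¹)) = q * q - 1 := by field_simp
  rw [e, sub_smul, one_smul]
  abel

theorem RowSelf.zero : RowSelf q (0 : ℕ → A) := by
  intro j k _; simp

theorem RowRel.zero_left (σ : ℕ → A) : RowRel q 0 σ := by
  constructor <;> intros <;> simp

theorem RowRel.zero_right (σ : ℕ → A) : RowRel q σ 0 := by
  constructor <;> intros <;> simp

end Tensor

/-- A letter records whether a row (or column) belongs to the first and to the second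
index set. -/
abbrev Letter := Bool × Bool

section Words

variable {R : Type}

/-- The rows of the first minor. -/
def upper (L : List (Letter × R)) : List R := (L.filter fun x => x.1.1).map Prod.snd

/-- The rows of the second minor. -/
def lower (L : List (Letter × R)) : List R := (L.filter fun x => x.1.2).map Prod.snd

@[simp] theorem upper_append (L M : List (Letter × R)) : upper (L ++ M) = upper L ++ upper M := by
  simp [upper]

@[simp] theorem lower_append (L M : List (Letter × R)) : lower (L ++ M) = lower L ++ lower M := by
  simp [lower]

@[simp] theorem upper_cons_true (b : Bool) (ρ : R) (L : List (Letter × R)) :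
    upper (((true, b), ρ) :: L) = ρ :: upper L := by simp [upper]

@[simp] theorem upper_cons_false (b : Bool) (ρ : R) (L : List (Letter × R)) :
    upper (((false, b), ρ) :: L) = upper L := by simp [upper]

@[simp] theorem lower_cons_true (b : Bool) (ρ : R) (L : List (Letter × R)) :
    lower (((b, true), ρ) :: L) = ρ :: lower L := by simp [lower]

@[simp] theorem lower_cons_false (b : Bool) (ρ : R) (L : List (Letter × R)) :
    lower (((b, false), ρ) :: L) = lower L := by simp [lower]

theorem upper_map {R' : Type} (f : R → R') (L : List (Letter × R)) :
    upper (L.map fun x => (x.1, f x.2)) = (upper L).map f := by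
  simp [upper, List.filter_map, Function.comp_def]

theorem lower_map {R' : Type} (f : R → R') (L : List (Letter × R)) :
    lower (L.map fun x => (x.1, f x.2)) = (lower L).map f := by
  simp [lower, List.filter_map, Function.comp_def]

end Words

section Reorder

variable {K : Type} [Field K]

/-- The two minors whose rows are prescribed by the word `w`, with column sets `J` and `J'`,
commute up to the factor `q ^ c`. -/
def RowQC (q : K) (w : List Letter) (J J' : Finset ℕ) (c : ℤ) : Prop :=
  ∀ (A : Type) [Ring A] [Algebra K A] (L : List (Letter × (ℕ → A))),
    L.map Prod.fst = w → RowsQ q (L.map Prod.snd) →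
      rowMinor q (upper L) J * rowMinor q (lower L) J' =
        q ^ c • (rowMinor q (lower L) J' * rowMinor q (upper L) J)

variable {q : K} {w₁ w₂ : List Letter} {J J' : Finset ℕ} {c : ℤ}

theorem RowsQ.of_cons {A : Type} [Ring A] [Algebra K A] {p s : List (ℕ → A)} {ρ : ℕ → A}
    (h : RowsQ q (p ++ ρ :: s)) : RowsQ q (p ++ s) := by
  have hs : List.Sublist (p ++ s) (p ++ ρ :: s) := by simp
  exact ⟨fun σ hσ => h.1 σ (hs.subset hσ), h.2.sublist hs⟩

theorem rowQC_delete_iff :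
    RowQC q (w₁ ++ (false, false) :: w₂) J J' c ↔ RowQC q (w₁ ++ w₂) J J' c := by
  constructor
  · intro h A _ _ L hL hQ
    obtain ⟨p, s, rfl, rfl, rfl⟩ := List.map_eq_append_iff.1 hL
    have := h A (p ++ ((false, false), 0) :: s) (by simp) ?_
    · simpa using this
    · simp only [RowsQ, List.map_append, List.map_cons, List.pairwise_append, List.pairwise_cons,
        List.mem_append, List.mem_cons] at hQ ⊢
      refine ⟨?_, hQ.2.1, ⟨fun _ _ => RowRel.zero_left _, hQ.2.2.1⟩, ?_⟩
      · rintro σ (hσ | rfl | hσ)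
        exacts [hQ.1 σ (.inl hσ), RowSelf.zero, hQ.1 σ (.inr hσ)]
      · rintro σ hσ τ (rfl | hτ)
        exacts [RowRel.zero_right _, hQ.2.2.2 σ hσ τ hτ]
  · intro h A _ _ L hL hQ
    obtain ⟨p, s', rfl, rfl, hs⟩ := List.map_eq_append_iff.1 hL
    obtain ⟨⟨x, ρ⟩, s, rfl, hx, rfl⟩ := List.map_eq_cons_iff.1 hs
    obtain rfl : x = (false, false) := hx
    have := h A (p ++ s) (by simp) ?_
    · simpa using this
    · simp only [List.map_append, List.map_cons] at hQ ⊢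
      exact hQ.of_cons

theorem RowQC.swap (hq : q ≠ 0) {w : List Letter} (h : RowQC q w J J' c) :
    RowQC q (w.map Prod.swap) J' J (-c) := by
  intro A _ _ L hL hQ
  have := h A (L.map fun x => (x.1.swap, x.2)) ?_ ?_
  · have e1 : upper (L.map fun x => (x.1.swap, x.2)) = lower L := by
      simp [upper, lower, List.filter_map, Function.comp_def]
    have e2 : lower (L.map fun x => (x.1.swap, x.2)) = upper L := by
      simp [upper, lower, List.filter_map, Function.comp_def]
    rw [e1, e2] at this
    rw [this, smul_smul, ← zpow_add₀ hq]
    simp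
  · have := congrArg (List.map Prod.swap) hL
    simpa [List.map_map, Function.comp_def] using this
  · simpa [List.map_map, Function.comp_def] using hQ

theorem rowQC_swap_iff (hq : q ≠ 0) {w : List Letter} :
    RowQC q (w.map Prod.swap) J J' c ↔ RowQC q w J' J (-c) := by
  constructor
  · intro h
    simpa [List.map_map, Function.comp_def] using h.swap hq
  · intro h
    simpa using h.swap hq

section Moves

variable {A : Type} [Ring A] [Algebra K A] {W : Type} [Ring W] [Algebra K W]

/-- Extension of scalars of a lettered list of rows. -/
def lift (W : Type) [Ring W] [Algebra K W] (L : List (Letter × (ℕ → A))) :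
    List (Letter × (ℕ → A ⊗[K] W)) :=
  L.map fun x => (x.1, tens (K := K) x.2 (1 : W))

theorem upper_lift (L : List (Letter × (ℕ → A))) :
    upper (lift (K := K) W L) = (upper L).map fun ρ => tens ρ 1 :=
  upper_map (fun ρ : ℕ → A => tens (K := K) ρ (1 : W)) L

theorem lower_lift (L : List (Letter × (ℕ → A))) :
    lower (lift (K := K) W L) = (lower L).map fun ρ => tens ρ 1 :=
  lower_map (fun ρ : ℕ → A => tens (K := K) ρ (1 : W)) L

theorem map_fst_lift (L : List (Letter × (ℕ → A))) :
    (lift (K := K) W L).map Prod.fst = L.map Prod.fst := by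
  simp [lift, Function.comp_def]

theorem map_snd_lift (L : List (Letter × (ℕ → A))) :
    (lift (K := K) W L).map Prod.snd = (L.map Prod.snd).map fun ρ => tens ρ 1 := by
  simp [lift, Function.comp_def]

theorem RowsQ.lift_two {p s : List (ℕ → A)} {M : List (ℕ → A)} (h : RowsQ q (p ++ M ++ s))
    {M' : List (ℕ → A ⊗[K] W)} (hM' : RowsQ q M')
    (hN : ∀ τ : ℕ → A, (∀ σ ∈ M, RowRel q τ σ) → ∀ σ ∈ M', RowRel q (tens (K := K) τ (1 : W)) σ)
    (hN' : ∀ τ : ℕ → A, (∀ σ ∈ M, RowRel q σ τ) → ∀ σ ∈ M', RowRel q σ (tens (K := K) τ (1 : W))) :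
    RowsQ q (p.map (fun ρ => tens (K := K) ρ (1 : W)) ++ M' ++ s.map (fun ρ => tens ρ 1)) := by
  simp only [RowsQ, List.pairwise_append, List.mem_append, List.pairwise_map, List.mem_map] at h ⊢
  obtain ⟨h1, ⟨h2, -, h3⟩, h4, h5⟩ := h
  have key : ∀ {σ τ : ℕ → A}, RowRel q σ τ → RowRel q (tens (K := K) σ (1 : W)) (tens τ 1) :=
    fun h => h.tens rfl
  refine ⟨?_, ⟨h2.imp key, hM'.2, ?_⟩, h4.imp key, ?_⟩
  · rintro σ ((⟨σ, hσ, rfl⟩ | hσ) | ⟨σ, hσ, rfl⟩)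
    exacts [(h1 σ (.inl (.inl hσ))).tens 1, hM'.1 σ hσ, (h1 σ (.inr hσ)).tens 1]
  · rintro _ ⟨σ, hσ, rfl⟩ τ hτ
    exact hN σ (fun τ hτ => h3 σ hσ τ hτ) τ hτ
  · rintro _ (⟨σ, hσ, rfl⟩ | hσ) _ ⟨τ, hτ, rfl⟩
    · exact key (h5 σ (.inl hσ) τ hτ)
    · exact hN' τ (fun ρ hρ => h5 ρ (.inr hρ) τ hτ) _ hσ

end Moves

theorem quantumTorus_inv {W : Type} [Ring W] [Algebra K W] {a b : Wˣ}
    (h : (a : W) * b = q • ((b : W) * a)) :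
    (b : W) * (a⁻¹ : Wˣ) = q • (((a⁻¹ : Wˣ) : W) * b) := by
  have := congrArg (fun t => ((a⁻¹ : Wˣ) : W) * t * (a⁻¹ : Wˣ)) h
  simpa [mul_assoc] using this

/-- Splitting a row occurring in both minors into two rows, each occurring in one of them. -/
theorem RowQC.contract (hq : q ≠ 0)
    (h : RowQC q (w₁ ++ (false, true) :: (true, false) :: w₂) J J' c) :
    RowQC q (w₁ ++ (true, true) :: w₂) J J' (c + 1) := by
  intro A _ _ L hL hQ
  obtain ⟨p, s', rfl, rfl, hs⟩ := List.map_eq_append_iff.1 hL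
  obtain ⟨⟨x, ρ⟩, s, rfl, hx, rfl⟩ := List.map_eq_cons_iff.1 hs
  obtain rfl : x = (true, true) := hx
  obtain ⟨W, _, _, _, a, b, hab⟩ := exists_quantumTorus hq
  simp only [List.map_append, List.map_cons] at hQ
  have hρ : RowSelf q ρ := hQ.1 ρ (by simp)
  have := h (A ⊗[K] W) (lift W p ++ ((false, true), tens ρ (a : W)) ::
    ((true, false), tens ρ (b : W)) :: lift W s) (by simp [map_fst_lift]) ?_
  · simp only [upper_append, lower_append, upper_cons_true, upper_cons_false, lower_cons_true,
      lower_cons_false, upper_lift, lower_lift, rowMinor_tens_one,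
      Algebra.TensorProduct.tmul_mul_tmul, hab] at this ⊢
    apply tmul_unit_injective (K := K) (b * a)
    rw [Units.val_mul, this, TensorProduct.tmul_smul, smul_smul, zpow_add_one₀ hq,
      TensorProduct.smul_tmul']
  · have := RowsQ.lift_two (W := W) (M := [ρ]) (p := p.map Prod.snd)
      (s := s.map Prod.snd) (by simpa using hQ) (M' := [tens ρ (a : W), tens ρ (b : W)])
      ⟨by simp [hρ.tens], by simp [hρ.rowRel_tens hq hab]⟩ ?_ ?_
    · simpa [map_snd_lift] using this
    · intro τ hτ
      simp only [List.mem_singleton, forall_eq] at hτ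
      simp [hτ.tens]
    · intro τ hτ
      simp only [List.mem_singleton, forall_eq] at hτ
      simp [hτ.tens]

theorem RowQC.contract' (hq : q ≠ 0)
    (h : RowQC q (w₁ ++ (true, false) :: (false, true) :: w₂) J J' c) :
    RowQC q (w₁ ++ (true, true) :: w₂) J J' (c - 1) := by
  have h1 := (h.swap hq)
  simp only [List.map_append, List.map_cons, Prod.swap_prod_mk] at h1
  have h2 := (h1.contract hq).swap hq
  simp only [List.map_append, List.map_cons, Prod.swap_prod_mk, List.map_map, Prod.swap_swap_eq,
    List.map_id, neg_add, neg_neg] at h2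
  simpa [sub_eq_add_neg] using h2

theorem RowQC.move_left (hq : q ≠ 0)
    (h : RowQC q (w₁ ++ (true, false) :: (true, true) :: w₂) J J' c) :
    RowQC q (w₁ ++ (true, true) :: (true, false) :: w₂) J J' c := by
  intro A _ _ L hL hQ
  obtain ⟨p, s', rfl, rfl, hs⟩ := List.map_eq_append_iff.1 hL
  obtain ⟨⟨x, ρ⟩, s'', rfl, hx, hs'⟩ := List.map_eq_cons_iff.1 hs
  obtain rfl : x = (true, true) := hx
  obtain ⟨⟨x, σ⟩, s, rfl, hx, rfl⟩ := List.map_eq_cons_iff.1 hs'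
  obtain rfl : x = (true, false) := hx
  obtain ⟨W, _, _, _, a, b, hab⟩ := exists_quantumTorus hq
  have hbd := quantumTorus_inv hab
  simp only [List.map_append, List.map_cons] at hQ
  have hρ : RowSelf q ρ := hQ.1 ρ (by simp)
  have hσ : RowSelf q σ := hQ.1 σ (by simp)
  have hρσ : RowRel q ρ σ := by
    have := hQ.2
    simp only [List.pairwise_append, List.pairwise_cons] at this
    exact this.2.1.1 _ (by simp)
  have h0 := h A (p ++ ((true, false), ρ) :: ((true, true), σ) :: s) (by simp) (by simpa using hQ)
  have := h (A ⊗[K] W) (lift W p ++ ((true, false), tens ρ (a : W)) ::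
    ((true, true), tens ρ (b : W) + tens σ ((a⁻¹ : Wˣ) : W)) :: lift W s)
    (by simp [map_fst_lift]) ?_
  · simp only [upper_append, lower_append, upper_cons_true, lower_cons_true,
      lower_cons_false, upper_lift, lower_lift] at this h0 ⊢
    have hadd := rowMinor_add q
      ((upper p).map (fun ρ => tens (K := K) ρ (1 : W)) ++ [tens ρ (a : W)])
      ((upper s).map (fun ρ => tens (K := K) ρ (1 : W))) (tens ρ (b : W))
      (tens σ ((a⁻¹ : Wˣ) : W)) J
    simp only [List.append_assoc, List.cons_append, List.nil_append] at hadd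
    rw [hadd, rowMinor_add, rowMinor_tens_two, rowMinor_tens_two, rowMinor_tens_one,
      rowMinor_tens_one, rowMinor_eq_zero_of_repeat q _ _ hρ, TensorProduct.zero_tmul, zero_add,
      Units.mul_inv] at this
    simp only [mul_add, add_mul, smul_add, Algebra.TensorProduct.tmul_mul_tmul, one_mul, mul_one,
      h0, TensorProduct.smul_tmul'] at this
    exact tmul_unit_injective (K := K) b (add_right_cancel this)
  · have := RowsQ.lift_two (W := W) (M := [ρ, σ]) (p := p.map Prod.snd)
      (s := s.map Prod.snd) (by simpa using hQ)
      (M' := [tens ρ (a : W), tens ρ (b : W) + tens σ ((a⁻¹ : Wˣ) : W)])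
      ⟨by simpa using ⟨hρ.tens _, hρ.add_tens hq hσ hρσ hbd⟩,
        by simpa using (hρ.rowRel_tens hq hab).add_right (hρσ.tens (by simp))⟩ ?_ ?_
    · simpa [map_snd_lift] using this
    · intro τ hτ
      simp only [List.mem_cons, List.not_mem_nil, or_false, forall_eq_or_imp, forall_eq] at hτ ⊢
      exact ⟨hτ.1.tens (by simp), (hτ.1.tens (by simp)).add_right (hτ.2.tens (by simp))⟩
    · intro τ hτ
      simp only [List.mem_cons, List.not_mem_nil, or_false, forall_eq_or_imp, forall_eq] at hτ ⊢
      exact ⟨hτ.1.tens (by simp), (hτ.1.tens (by simp)).add_left (hτ.2.tens (by simp))⟩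

theorem RowQC.move_right (hq : q ≠ 0)
    (h : RowQC q (w₁ ++ (true, true) :: (true, false) :: w₂) J J' c) :
    RowQC q (w₁ ++ (true, false) :: (true, true) :: w₂) J J' c := by
  intro A _ _ L hL hQ
  obtain ⟨p, s', rfl, rfl, hs⟩ := List.map_eq_append_iff.1 hL
  obtain ⟨⟨x, ρ⟩, s'', rfl, hx, hs'⟩ := List.map_eq_cons_iff.1 hs
  obtain rfl : x = (true, false) := hx
  obtain ⟨⟨x, σ⟩, s, rfl, hx, rfl⟩ := List.map_eq_cons_iff.1 hs'
  obtain rfl : x = (true, true) := hx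
  obtain ⟨W, _, _, _, a, b, hab⟩ := exists_quantumTorus hq
  have hbd := quantumTorus_inv hab
  simp only [List.map_append, List.map_cons] at hQ
  have hρ : RowSelf q ρ := hQ.1 ρ (by simp)
  have hσ : RowSelf q σ := hQ.1 σ (by simp)
  have hρσ : RowRel q ρ σ := by
    have := hQ.2
    simp only [List.pairwise_append, List.pairwise_cons] at this
    exact this.2.1.1 _ (by simp)
  have h0 := h A (p ++ ((true, true), ρ) :: ((true, false), σ) :: s) (by simp) (by simpa using hQ)
  have := h (A ⊗[K] W) (lift W p ++ ((true, true), tens ρ (a : W) + tens σ (b : W)) ::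
    ((true, false), tens σ ((a⁻¹ : Wˣ) : W)) :: lift W s)
    (by simp [map_fst_lift]) ?_
  · simp only [upper_append, lower_append, upper_cons_true, lower_cons_true,
      lower_cons_false, upper_lift, lower_lift] at this h0 ⊢
    rw [rowMinor_add, rowMinor_add, rowMinor_tens_two, rowMinor_tens_two, rowMinor_tens_one,
      rowMinor_tens_one, rowMinor_eq_zero_of_repeat q _ _ hσ, TensorProduct.zero_tmul, add_zero,
      Units.mul_inv] at this
    simp only [mul_add, add_mul, smul_add, Algebra.TensorProduct.tmul_mul_tmul, one_mul, mul_one,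
      h0, TensorProduct.smul_tmul'] at this
    exact tmul_unit_injective (K := K) b (add_left_cancel this)
  · have := RowsQ.lift_two (W := W) (M := [ρ, σ]) (p := p.map Prod.snd)
      (s := s.map Prod.snd) (by simpa using hQ)
      (M' := [tens ρ (a : W) + tens σ (b : W), tens σ ((a⁻¹ : Wˣ) : W)])
      ⟨by simpa using ⟨hρ.add_tens hq hσ hρσ hab, hσ.tens _⟩,
        by simpa using (hρσ.tens (by simp)).add_left (hσ.rowRel_tens hq hbd)⟩ ?_ ?_
    · simpa [map_snd_lift] using this
    · intro τ hτ
      simp only [List.mem_cons, List.not_mem_nil, or_false, forall_eq_or_imp, forall_eq] at hτ ⊢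
      exact ⟨(hτ.1.tens (by simp)).add_right (hτ.2.tens (by simp)), hτ.2.tens (by simp)⟩
    · intro τ hτ
      simp only [List.mem_cons, List.not_mem_nil, or_false, forall_eq_or_imp, forall_eq] at hτ ⊢
      exact ⟨(hτ.1.tens (by simp)).add_left (hτ.2.tens (by simp)), hτ.2.tens (by simp)⟩

/-- A row occurring in both minors may be moved past any other row. -/
theorem rowQC_move_iff (hq : q ≠ 0) (x : Letter) :
    RowQC q (w₁ ++ x :: (true, true) :: w₂) J J' c ↔
      RowQC q (w₁ ++ (true, true) :: x :: w₂) J J' c := by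
  have hW : ∀ {w₁ w₂ : List Letter} {J J' : Finset ℕ} {c : ℤ},
      RowQC q (w₁ ++ (true, false) :: (true, true) :: w₂) J J' c ↔
        RowQC q (w₁ ++ (true, true) :: (true, false) :: w₂) J J' c :=
    ⟨fun h => h.move_left hq, fun h => h.move_right hq⟩
  obtain ⟨_ | _, _ | _⟩ := x
  · have := rowQC_delete_iff (q := q) (w₁ := w₁ ++ [(true, true)]) (w₂ := w₂) (J := J) (J' := J')
      (c := c)
    rw [rowQC_delete_iff]
    simpa using this.symm
  · have := hW (w₁ := w₁.map Prod.swap) (w₂ := w₂.map Prod.swap) (J := J') (J' := J) (c := -c)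
    rw [← rowQC_swap_iff hq, ← rowQC_swap_iff hq] at this
    simpa [List.map_map, Function.comp_def] using this
  · exact hW
  · rfl

theorem rowQC_front_iff (hq : q ≠ 0) :
    RowQC q (w₁ ++ (true, true) :: w₂) J J' c ↔ RowQC q ((true, true) :: w₁ ++ w₂) J J' c := by
  induction w₁ using List.reverseRecOn generalizing w₂ with
  | nil => rfl
  | append_singleton w x ih =>
    rw [List.append_assoc, List.singleton_append, rowQC_move_iff hq, ih]
    simp

end Reorder

section Permutations

theorem permInversions_eq_sum {k : ℕ} (σ : Equiv.Perm (Fin k)) :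
    permInversions σ = ∑ i, ∑ j, if i < j ∧ σ j < σ i then 1 else 0 := by
  rw [permInversions, Finset.card_filter, ← Finset.univ_product_univ, Finset.sum_product]

theorem permInversions_inv {k : ℕ} (σ : Equiv.Perm (Fin k)) :
    permInversions σ⁻¹ = permInversions σ := by
  refine Finset.card_bij (fun p _ => (σ⁻¹ p.2, σ⁻¹ p.1)) ?_ ?_ ?_
  · rintro ⟨a, b⟩ h
    simp only [Finset.mem_filter, Finset.mem_univ, true_and] at h ⊢
    simpa using h.symm
  · rintro ⟨a, b⟩ _ ⟨c, d⟩ _ h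
    simp only [Prod.mk.injEq, EmbeddingLike.apply_eq_iff_eq] at h ⊢
    exact h.symm
  · rintro ⟨a, b⟩ h
    simp only [Finset.mem_filter, Finset.mem_univ, true_and] at h
    exact ⟨(σ b, σ a), by simpa using h.symm, by simp⟩

/-- The permutation of `Fin (k + 1)` sending `0` to `p` and acting as `τ` on the others. -/
def consPerm {k : ℕ} (p : Fin (k + 1)) (τ : Equiv.Perm (Fin k)) : Equiv.Perm (Fin (k + 1)) :=
  (finSuccEquiv' 0).trans ((Equiv.optionCongr τ).trans (finSuccEquiv' p).symm)

@[simp] theorem consPerm_zero {k : ℕ} (p : Fin (k + 1)) (τ : Equiv.Perm (Fin k)) :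
    consPerm p τ 0 = p := by
  simp [consPerm]

@[simp] theorem consPerm_succ {k : ℕ} (p : Fin (k + 1)) (τ : Equiv.Perm (Fin k)) (d : Fin k) :
    consPerm p τ d.succ = p.succAbove (τ d) := by
  have : (finSuccEquiv' (0 : Fin (k + 1))) d.succ = some d := by
    rw [← Fin.succAbove_zero, finSuccEquiv'_succAbove]
  simp [consPerm, this]

theorem consPerm_bijective (k : ℕ) :
    Function.Bijective fun a : Fin (k + 1) × Equiv.Perm (Fin k) => consPerm a.1 a.2 := by
  rw [Fintype.bijective_iff_injective_and_card]
  constructor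
  · rintro ⟨p, τ⟩ ⟨p', τ'⟩ h
    simp only at h
    obtain rfl : p = p' := by simpa using congrArg (fun σ => σ 0) h
    have : τ = τ' := by
      ext1 d
      have := congrArg (fun σ => σ d.succ) h
      simpa using this
    rw [this]
  · simp [Fintype.card_perm, Nat.factorial_succ]

theorem permInversions_consPerm {k : ℕ} (p : Fin (k + 1)) (τ : Equiv.Perm (Fin k)) :
    permInversions (consPerm p τ) = p + permInversions τ := by
  simp only [permInversions_eq_sum, Fin.sum_univ_succ, consPerm_zero, consPerm_succ,
    false_and, if_false, zero_add, Fin.succ_pos, true_and, Fin.not_lt_zero,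
    Fin.succ_lt_succ_iff, Fin.succAbove_lt_succAbove_iff, Fin.succAbove_lt_iff_castSucc_lt]
  congr 1
  rw [Equiv.sum_comp τ (fun d : Fin k => if d.castSucc < p then 1 else 0)]
  have := Fin.sum_univ_eq_sum_range (fun i => if i < (p : ℕ) then 1 else 0) k
  simp only [Fin.lt_def, Fin.val_castSucc]
  rw [this, ← Finset.card_filter]
  have : (Finset.range k).filter (fun i => i < (p : ℕ)) = Finset.range p := by
    ext i
    have := p.2
    simp only [Finset.mem_filter, Finset.mem_range]
    omega
  rw [this, Finset.card_range]

end Permutations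

section Link

variable {K : Type} [Field K] {A : Type} [Ring A] [Algebra K A] (q : K)

theorem sum_orderEmbOfFin {M : Type} [AddCommMonoid M] (J : Finset ℕ) {k : ℕ} (h : J.card = k)
    (f : ℕ → M) : ∑ p, f (J.orderEmbOfFin h p) = ∑ j ∈ J, f j := by
  conv_rhs => rw [← Finset.map_orderEmbOfFin_univ J h, Finset.sum_map]
  rfl

theorem card_filter_lt_orderEmbOfFin (J : Finset ℕ) {k : ℕ} (h : J.card = k) (p : Fin k) :
    (J.filter (· < J.orderEmbOfFin h p)).card = p := by
  have hJ : J.filter (· < J.orderEmbOfFin h p) =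
      (Finset.univ.map (J.orderEmbOfFin h).toEmbedding).filter (· < J.orderEmbOfFin h p) := by
    rw [Finset.map_orderEmbOfFin_univ]
  have hp : Finset.univ.filter ((· < J.orderEmbOfFin h p) ∘ (J.orderEmbOfFin h).toEmbedding) =
      Finset.Iio p := by
    ext i
    simp
  rw [hJ, Finset.filter_map, Finset.card_map, hp, Fin.card_Iio]

theorem orderEmbOfFin_erase (J : Finset ℕ) {k : ℕ} (h : J.card = k + 1) (p : Fin (k + 1))
    (h' : (J.erase (J.orderEmbOfFin h p)).card = k) (d : Fin k) :
    (J.erase (J.orderEmbOfFin h p)).orderEmbOfFin h' d = J.orderEmbOfFin h (p.succAbove d) := by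
  have := Finset.orderEmbOfFin_unique h' (f := fun d => J.orderEmbOfFin h (p.succAbove d)) ?_ ?_
  · exact (congrFun this d).symm
  · intro d
    simp [Fin.succAbove_ne]
  · exact (J.orderEmbOfFin h).strictMono.comp (Fin.strictMono_succAbove p)

theorem sum_perm_eq_rowMinor {k : ℕ} (r : Fin k → ℕ → A) (J : Finset ℕ) (h : J.card = k) :
    ∑ σ : Equiv.Perm (Fin k), ((-q) ^ permInversions σ) •
      (List.ofFn fun d => r d (J.orderEmbOfFin h (σ d))).prod = rowMinor q (List.ofFn r) J := by
  induction k generalizing J with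
  | zero =>
    have : J = ∅ := Finset.card_eq_zero.1 h
    simp [rowMinor, this, permInversions]
  | succ k ih =>
    rw [List.ofFn_succ, rowMinor, ← sum_orderEmbOfFin J h,
      ← (consPerm_bijective k).sum_comp, Fintype.sum_prod_type]
    refine Finset.sum_congr rfl fun p _ => ?_
    have h' : (J.erase (J.orderEmbOfFin h p)).card = k := by
      rw [Finset.card_erase_of_mem (Finset.orderEmbOfFin_mem J h p), h]
      rfl
    rw [← ih _ _ h', card_filter_lt_orderEmbOfFin, Finset.mul_sum, Finset.smul_sum]
    refine Finset.sum_congr rfl fun τ _ => ?_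
    simp only [permInversions_consPerm, List.ofFn_succ, consPerm_zero, consPerm_succ,
      List.prod_cons, orderEmbOfFin_erase, mul_smul_comm, smul_smul, pow_add]

theorem ofFn_orderEmbOfFin (I : Finset ℕ) {k : ℕ} (h : I.card = k) :
    List.ofFn (I.orderEmbOfFin h) = I.sort := by
  refine List.ext_getElem (by simp [h]) fun i h₁ h₂ => ?_
  simp [Finset.orderEmbOfFin_apply]

theorem qMinor_eq_rowMinor (x : ℕ → ℕ → A) (I J : Finset ℕ) :
    qMinor q x I J = rowMinor q (I.sort.map x) J := by
  by_cases h : I.card = J.card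
  · rw [qMinor, dif_pos h, sum_perm_eq_rowMinor q (fun d => x (I.orderEmbOfFin rfl d)) J h.symm,
      ← ofFn_orderEmbOfFin I rfl, List.map_ofFn]
    rfl
  · rw [qMinor, dif_neg h, rowMinor_eq_zero_of_length_ne]
    simpa using h

/-- A `q`-matrix with rows and columns indexed by all natural numbers. -/
def FullQ (x : ℕ → ℕ → A) : Prop :=
  (∀ i, RowSelf q (x i)) ∧ ∀ i l, i < l → RowRel q (x i) (x l)

variable {q}

theorem FullQ.transpose {x : ℕ → ℕ → A} (h : FullQ q x) : FullQ q fun i j => x j i := by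
  refine ⟨fun j a b hab => (h.2 a b hab).col j, fun j k hjk => ⟨fun a => h.1 a j k hjk,
    fun a b hab => ((h.2 a b hab).anti j k hjk).symm, fun a b hab => ?_⟩⟩
  rw [(h.2 a b hab).diag j k hjk, (h.2 a b hab).anti j k hjk]

theorem prod_map_eq_of_perm {ι M : Type} [Monoid M] (f : ι → M) {R S : ι → ι → Prop}
    (H : ∀ a b, R a b → S b a → Commute (f a) (f b)) {l₁ l₂ : List ι} (h : l₁.Perm l₂)
    (h₁ : l₁.Pairwise R) (h₂ : l₂.Pairwise S) : (l₁.map f).prod = (l₂.map f).prod := by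
  induction l₁ generalizing l₂ with
  | nil => rw [List.nil_perm.1 h]
  | cons a l₁ ih =>
    obtain ⟨p, s, rfl⟩ := List.append_of_mem (h.subset List.mem_cons_self)
    have hp : l₁.Perm (p ++ s) := (h.trans List.perm_middle).cons_inv
    have hc : Commute (f a) (p.map f).prod := by
      refine Commute.list_prod_right _ _ fun y hy => ?_
      obtain ⟨b, hb, rfl⟩ := List.mem_map.1 hy
      exact H a b (List.rel_of_pairwise_cons h₁ (hp.symm.subset (by simp [hb])))
        ((List.pairwise_append.1 h₂).2.2 b hb a List.mem_cons_self)
    have hs : List.Sublist (p ++ s) (p ++ a :: s) := by simp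
    rw [List.map_cons, List.prod_cons, ih hp h₁.of_cons (h₂.sublist hs)]
    simp only [List.map_append, List.map_cons, List.prod_append, List.prod_cons, ← mul_assoc, hc.eq]

theorem qMinor_transpose {x : ℕ → ℕ → A} (h : FullQ q x) (I J : Finset ℕ) :
    qMinor q x I J = qMinor q (fun i j => x j i) J I := by
  by_cases hc : I.card = J.card
  · have key : ∀ k (hI : I.card = k) (hJ : J.card = k),
        ∑ σ : Equiv.Perm (Fin k), ((-q) ^ permInversions σ) •
          (List.ofFn fun d => x (I.orderEmbOfFin hI d) (J.orderEmbOfFin hJ (σ d))).prod =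
        ∑ σ : Equiv.Perm (Fin k), ((-q) ^ permInversions σ) •
          (List.ofFn fun d => x (I.orderEmbOfFin hI (σ d)) (J.orderEmbOfFin hJ d)).prod := by
      intro k hI hJ
      rw [← Equiv.sum_comp (Equiv.inv (Equiv.Perm (Fin k)))]
      refine Finset.sum_congr rfl fun σ _ => ?_
      simp only [Equiv.inv_apply, permInversions_inv]
      congr 1
      simp only [List.ofFn_eq_map]
      have := prod_map_eq_of_perm
        (fun d => x (I.orderEmbOfFin hI d) (J.orderEmbOfFin hJ (σ⁻¹ d)))
        (R := fun a b => a < b) (S := fun a b => σ⁻¹ a < σ⁻¹ b) (l₁ := List.finRange k)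
        (l₂ := (List.finRange k).map σ) ?_ (Equiv.Perm.map_finRange_perm σ).symm
        (List.pairwise_lt_finRange k) ?_
      · rw [this, List.map_map]
        simp [Function.comp_def]
      · intro a b hab hba
        exact (h.2 _ _ ((I.orderEmbOfFin hI).strictMono hab)).anti _ _
          ((J.orderEmbOfFin hJ).strictMono hba)
      · rw [List.pairwise_map]
        simpa using List.pairwise_lt_finRange k
    have h1 := key _ rfl hc.symm
    have h2 := key _ hc rfl
    rw [qMinor, qMinor, dif_pos hc, dif_pos hc.symm, h1]
    have h3 : ∀ k k' (hk : k = k') (hI : I.card = k) (hJ : J.card = k)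
        (hI' : I.card = k') (hJ' : J.card = k'),
        ∑ σ : Equiv.Perm (Fin k), ((-q) ^ permInversions σ) •
          (List.ofFn fun d => x (I.orderEmbOfFin hI (σ d)) (J.orderEmbOfFin hJ d)).prod =
        ∑ σ : Equiv.Perm (Fin k'), ((-q) ^ permInversions σ) •
          (List.ofFn fun d => x (I.orderEmbOfFin hI' (σ d)) (J.orderEmbOfFin hJ' d)).prod := by
      rintro k _ rfl _ _ _ _
      rfl
    exact h3 _ _ hc _ _ _ _
  · rw [qMinor, qMinor, dif_neg hc, dif_neg fun h => hc h.symm]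

end Link

section QC

variable {K : Type} [Field K] {q : K}

/-- The minors `[I|J]` and `[I'|J']` of any `q`-matrix commute up to the factor `q ^ c`. -/
def QC (q : K) (I J I' J' : Finset ℕ) (c : ℤ) : Prop :=
  ∀ (A : Type) [Ring A] [Algebra K A] (x : ℕ → ℕ → A), FullQ q x →
    qMinor q x I J * qMinor q x I' J' = q ^ c • (qMinor q x I' J' * qMinor q x I J)

theorem QC.transpose {I J I' J' : Finset ℕ} {c : ℤ} (h : QC q I J I' J' c) :
    QC q J I J' I' c := by
  intro A _ _ x hx
  rw [qMinor_transpose hx, qMinor_transpose hx]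
  exact h A _ hx.transpose

theorem QC.symm (hq : q ≠ 0) {I J I' J' : Finset ℕ} {c : ℤ} (h : QC q I J I' J' c) :
    QC q I' J' I J (-c) := by
  intro A _ _ x hx
  rw [h A x hx, smul_smul, ← zpow_add₀ hq]
  simp

/-- The positions of the letters of `w`, as labels for them. -/
def labelled (w : List Letter) : List (Letter × ℕ) := w.zipIdx

/-- The set of positions belonging to the first index set. -/
def fstSet (w : List Letter) : Finset ℕ := (upper (labelled w)).toFinset

/-- The set of positions belonging to the second index set. -/
def sndSet (w : List Letter) : Finset ℕ := (lower (labelled w)).toFinset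

theorem map_fst_labelled (w : List Letter) : (labelled w).map Prod.fst = w := by
  simp [labelled]

theorem map_snd_labelled (w : List Letter) :
    (labelled w).map Prod.snd = List.range w.length := by
  simp [labelled, List.range_eq_range']

theorem pairwise_upper_labelled (w : List Letter) : (upper (labelled w)).Pairwise (· < ·) := by
  have h : List.Sublist (upper (labelled w)) (List.range w.length) := by
    rw [← map_snd_labelled]
    exact List.filter_sublist.map _
  exact List.pairwise_lt_range.sublist h

theorem pairwise_lower_labelled (w : List Letter) : (lower (labelled w)).Pairwise (· < ·) := by
  have h : List.Sublist (lower (labelled w)) (List.range w.length) := by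
    rw [← map_snd_labelled]
    exact List.filter_sublist.map _
  exact List.pairwise_lt_range.sublist h

theorem sort_fstSet (w : List Letter) : (fstSet w).sort = upper (labelled w) := by
  have h := pairwise_upper_labelled w
  exact (List.toFinset_sort _ (h.imp ne_of_lt)).2 (h.imp le_of_lt)

theorem sort_sndSet (w : List Letter) : (sndSet w).sort = lower (labelled w) := by
  have h := pairwise_lower_labelled w
  exact (List.toFinset_sort _ (h.imp ne_of_lt)).2 (h.imp le_of_lt)

theorem rowQC_iff_qc {w : List Letter} {J J' : Finset ℕ} {c : ℤ} :
    RowQC q w J J' c ↔ QC q (fstSet w) J (sndSet w) J' c := by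
  constructor
  · intro h A _ _ x hx
    have := h A ((labelled w).map fun y => (y.1, x y.2)) ?_ ?_
    · rw [upper_map, lower_map] at this
      rwa [qMinor_eq_rowMinor, qMinor_eq_rowMinor, sort_fstSet, sort_sndSet]
    · rw [List.map_map]
      exact map_fst_labelled w
    · have e : ((labelled w).map fun y => (y.1, x y.2)).map Prod.snd =
          (List.range w.length).map x := by
        rw [← map_snd_labelled, List.map_map, List.map_map]
        rfl
      rw [e]
      refine ⟨?_, ?_⟩
      · intro ρ hρ
        obtain ⟨i, -, rfl⟩ := List.mem_map.1 hρ
        exact hx.1 i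
      · rw [List.pairwise_map]
        exact List.pairwise_lt_range.imp fun {a b} hab => hx.2 a b hab
  · intro h A _ _ L hL hQ
    have := h A (fun i => (L.map Prod.snd).getD i 0) ?_
    · have e : L = (labelled w).map fun y => (y.1, (fun i => (L.map Prod.snd).getD i 0) y.2) := by
        subst hL
        refine List.ext_getElem (by simp [labelled]) fun i h₁ h₂ => ?_
        simp [labelled, h₁]
      rw [qMinor_eq_rowMinor, qMinor_eq_rowMinor, sort_fstSet, sort_sndSet, ← upper_map,
        ← lower_map, ← e] at this
      exact this
    · constructor
      · intro i
        beta_reduce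
        rcases lt_or_ge i (L.map Prod.snd).length with hi | hi
        · rw [List.getD_eq_getElem _ _ hi]
          exact hQ.1 _ (List.getElem_mem hi)
        · rw [List.getD_eq_default _ _ hi]
          exact RowSelf.zero
      · intro i l hil
        beta_reduce
        rcases lt_or_ge l (L.map Prod.snd).length with hl | hl
        · rw [List.getD_eq_getElem _ _ hl, List.getD_eq_getElem _ _ (hil.trans hl)]
          exact List.pairwise_iff_getElem.1 hQ.2 i l _ _ hil
        · rw [List.getD_eq_default _ _ hl]
          exact RowRel.zero_right _

/-- Quasicommutation of the two minors whose row and column sets are prescribed by the words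
`w` and `v`. -/
def WordQC (q : K) (w v : List Letter) (c : ℤ) : Prop :=
  QC q (fstSet w) (fstSet v) (sndSet w) (sndSet v) c

theorem wordQC_iff_rowQC {w v : List Letter} {c : ℤ} :
    WordQC q w v c ↔ RowQC q w (fstSet v) (sndSet v) c := rowQC_iff_qc.symm

theorem wordQC_comm {w v : List Letter} {c : ℤ} : WordQC q w v c ↔ WordQC q v w c :=
  ⟨QC.transpose, QC.transpose⟩

end QC

section WordSets

theorem mem_fstSet {w : List Letter} {i : ℕ} : i ∈ fstSet w ↔ ∃ b, w[i]? = some (true, b) := by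
  simp only [fstSet, upper, labelled, List.mem_toFinset, List.mem_map, List.mem_filter,
    Prod.exists, List.mem_zipIdx_iff_getElem?, exists_eq_right]
  constructor
  · rintro ⟨a, b, h, ha⟩
    obtain rfl : a = true := ha
    exact ⟨b, h⟩
  · rintro ⟨b, h⟩
    exact ⟨true, b, h, rfl⟩

theorem mem_sndSet {w : List Letter} {i : ℕ} : i ∈ sndSet w ↔ ∃ a, w[i]? = some (a, true) := by
  simp only [sndSet, lower, labelled, List.mem_toFinset, List.mem_map, List.mem_filter,
    Prod.exists, List.mem_zipIdx_iff_getElem?, exists_eq_right]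

/-- The word describing the membership of `0, …, N - 1` in `I` and `I'`. -/
def wordOf (N : ℕ) (I I' : Finset ℕ) : List Letter :=
  (List.range N).map fun i => (decide (i ∈ I), decide (i ∈ I'))

theorem fstSet_wordOf {N : ℕ} {I I' : Finset ℕ} (h : I ⊆ Finset.range N) :
    fstSet (wordOf N I I') = I := by
  ext i
  simp only [mem_fstSet, wordOf, List.getElem?_map, Option.map_eq_some_iff]
  constructor
  · rintro ⟨b, a, ha, hb⟩
    obtain ⟨hN, rfl⟩ := List.getElem?_eq_some_iff.1 ha
    simp only [List.getElem_range, Prod.mk.injEq, decide_eq_true_eq] at hb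
    exact hb.1
  · intro hi
    have hN := Finset.mem_range.1 (h hi)
    exact ⟨decide (i ∈ I'), i, by simp [hN], by simp [hi]⟩

theorem sndSet_wordOf {N : ℕ} {I I' : Finset ℕ} (h : I' ⊆ Finset.range N) :
    sndSet (wordOf N I I') = I' := by
  ext i
  simp only [mem_sndSet, wordOf, List.getElem?_map, Option.map_eq_some_iff]
  constructor
  · rintro ⟨b, a, ha, hb⟩
    obtain ⟨hN, rfl⟩ := List.getElem?_eq_some_iff.1 ha
    simp only [List.getElem_range, Prod.mk.injEq, decide_eq_true_eq] at hb
    exact hb.2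
  · intro hi
    have hN := Finset.mem_range.1 (h hi)
    exact ⟨decide (i ∈ I), i, by simp [hN], by simp [hi]⟩

theorem wordQC_wordOf {K : Type} [Field K] {q : K} {M N : ℕ} {I I' J J' : Finset ℕ} {c : ℤ}
    (hI : I ⊆ Finset.range M) (hI' : I' ⊆ Finset.range M) (hJ : J ⊆ Finset.range N)
    (hJ' : J' ⊆ Finset.range N) :
    WordQC q (wordOf M I I') (wordOf N J J') c ↔ QC q I J I' J' c := by
  rw [WordQC, fstSet_wordOf hI, fstSet_wordOf hJ, sndSet_wordOf hI', sndSet_wordOf hJ']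

/-- The letter of an index belonging to exactly one of the two sets. -/
def Mixed (l : Letter) : Bool := l.1 != l.2

theorem count_wordOf {N : ℕ} {I I' : Finset ℕ} (h : I ∪ I' ⊆ Finset.range N) (l : Letter)
    (hl : l ≠ (false, false)) : (wordOf N I I').count l =
      ((I ∪ I').filter fun i => (decide (i ∈ I), decide (i ∈ I')) = l).card := by
  have : (I ∪ I').filter (fun i => (decide (i ∈ I), decide (i ∈ I')) = l) =
      (Finset.range N).filter (fun i => (decide (i ∈ I), decide (i ∈ I')) = l) := by
    ext i
    simp only [Finset.mem_filter, and_congr_left_iff]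
    rintro rfl
    refine ⟨fun hi => h hi, fun _ => ?_⟩
    by_contra hi
    simp only [Finset.mem_union, not_or] at hi
    simp [hi] at hl
  rw [this, wordOf, List.count_eq_countP, List.countP_map, List.countP_eq_length_filter,
    ← List.toFinset_card_of_nodup (List.nodup_range.filter _)]
  congr 1
  ext i
  simp [Prod.ext_iff]

theorem count_both_wordOf {N : ℕ} {I I' : Finset ℕ} (h : I ∪ I' ⊆ Finset.range N) :
    (wordOf N I I').count (true, true) = (I ∩ I').card := by
  rw [count_wordOf h _ (by simp)]
  congr 1
  ext i
  simp only [Finset.mem_filter, Finset.mem_union, Prod.mk.injEq, decide_eq_true_eq,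
    Finset.mem_inter]
  tauto

theorem count_fst_wordOf {N : ℕ} {I I' : Finset ℕ} (h : I ∪ I' ⊆ Finset.range N) :
    (wordOf N I I').count (true, false) = (I \ I').card := by
  rw [count_wordOf h _ (by simp)]
  congr 1
  ext i
  simp only [Finset.mem_filter, Finset.mem_union, Prod.mk.injEq, decide_eq_true_eq,
    Finset.mem_sdiff, decide_eq_false_iff_not]
  tauto

theorem count_snd_wordOf {N : ℕ} {I I' : Finset ℕ} (h : I ∪ I' ⊆ Finset.range N) :
    (wordOf N I I').count (false, true) = (I' \ I).card := by
  rw [count_wordOf h _ (by simp)]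
  congr 1
  ext i
  simp only [Finset.mem_filter, Finset.mem_union, Prod.mk.injEq, decide_eq_true_eq,
    Finset.mem_sdiff, decide_eq_false_iff_not]
  tauto

end WordSets

section Normalize

variable {K : Type} [Field K] {q : K}

theorem rowQC_normalize (hq : q ≠ 0) {w : List Letter} {J J' : Finset ℕ} {c : ℤ} :
    RowQC q w J J' c ↔
      RowQC q (List.replicate (w.count (true, true)) (true, true) ++ w.filter Mixed) J J' c := by
  suffices h : ∀ u : List Letter, RowQC q (u ++ w) J J' c ↔
      RowQC q (List.replicate (w.count (true, true)) (true, true) ++ u ++ w.filter Mixed) J J' c by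
    simpa using h []
  induction w with
  | nil => simp
  | cons x w ih =>
    intro u
    obtain ⟨_ | _, _ | _⟩ := x
    · rw [rowQC_delete_iff, ih]
      simp [Mixed]
    · have := ih (u ++ [(false, true)])
      simpa [Mixed] using this
    · have := ih (u ++ [(true, false)])
      simpa [Mixed] using this
    · rw [rowQC_front_iff hq, ih]
      simp only [List.count_cons_self, List.replicate_succ']
      simp [Mixed]

theorem wordQC_normalize (hq : q ≠ 0) {w v : List Letter} {c : ℤ} :
    WordQC q w v c ↔
      WordQC q (List.replicate (w.count (true, true)) (true, true) ++ w.filter Mixed)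
        (List.replicate (v.count (true, true)) (true, true) ++ v.filter Mixed) c := by
  rw [wordQC_iff_rowQC, rowQC_normalize hq, ← wordQC_iff_rowQC, wordQC_comm, wordQC_iff_rowQC,
    rowQC_normalize hq, ← wordQC_iff_rowQC, wordQC_comm]

theorem wordQC_contract (hq : q ≠ 0) {w₁ w₂ v : List Letter} {c : ℤ}
    (h : WordQC q (w₁ ++ (false, true) :: (true, false) :: w₂) v c) :
    WordQC q ((true, true) :: w₁ ++ w₂) v (c + 1) := by
  rw [wordQC_iff_rowQC] at h ⊢
  exact (rowQC_front_iff hq).1 (h.contract hq)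

theorem wordQC_contract' (hq : q ≠ 0) {w₁ w₂ v : List Letter} {c : ℤ}
    (h : WordQC q (w₁ ++ (true, false) :: (false, true) :: w₂) v c) :
    WordQC q ((true, true) :: w₁ ++ w₂) v (c - 1) := by
  rw [wordQC_iff_rowQC] at h ⊢
  exact (rowQC_front_iff hq).1 (h.contract' hq)

theorem qc_of_finsetLT {I J I' J' : Finset ℕ} (h : finsetLT I' I) (h' : finsetLT J J') :
    QC q I J I' J' 0 := by
  intro A _ _ x hx
  have : Commute (qMinor q x I J) (qMinor q x I' J') := by
    rw [qMinor_eq_rowMinor, qMinor_eq_rowMinor]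
    refine commute_rowMinor fun ρ hρ j' hj' => (commute_rowMinor fun σ hσ j hj => ?_).symm
    obtain ⟨i', hi', rfl⟩ := List.mem_map.1 hρ
    obtain ⟨i, hi, rfl⟩ := List.mem_map.1 hσ
    simp only [Finset.mem_sort] at hi hi'
    exact (hx.2 _ _ (h i' hi' i hi)).anti _ _ (h' j hj j' hj')
  simpa using this.eq

theorem wordQC_blocks (hq : q ≠ 0) (k l a b a' b' : ℕ) (h : k + a = l + a')
    (h' : k + b = l + b') :
    WordQC q (List.replicate k (true, true) ++
        (List.replicate b (false, true) ++ List.replicate a (true, false)))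
      (List.replicate l (true, true) ++
        (List.replicate a' (true, false) ++ List.replicate b' (false, true))) (k - l) := by
  induction k generalizing l a b a' b' with
  | succ k ih =>
    have := ih l (a + 1) (b + 1) a' b' (by omega) (by omega)
    have e : List.replicate k (true, true) ++ (List.replicate (b + 1) (false, true) ++
        List.replicate (a + 1) (true, false)) =
        (List.replicate k (true, true) ++ List.replicate b (false, true)) ++
          (false, true) :: (true, false) :: List.replicate a (true, false) := by
      rw [List.replicate_succ', List.replicate_succ]
      simp
    rw [e] at this
    have := wordQC_contract hq this
    rw [show (k : ℤ) - l + 1 = ((k + 1 : ℕ) : ℤ) - l by push_cast; ring] at this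
    simpa [List.replicate_succ] using this
  | zero =>
    induction l generalizing a b a' b' with
    | succ l ih =>
      have := ih a b (a' + 1) (b' + 1) (by omega) (by omega)
      have e : List.replicate l (true, true) ++ (List.replicate (a' + 1) (true, false) ++
          List.replicate (b' + 1) (false, true)) =
          (List.replicate l (true, true) ++ List.replicate a' (true, false)) ++
            (true, false) :: (false, true) :: List.replicate b' (false, true) := by
        rw [List.replicate_succ', List.replicate_succ]
        simp
      rw [e, wordQC_comm] at this
      have := wordQC_contract' hq this
      rw [show ((0 : ℕ) : ℤ) - l - 1 = ((0 : ℕ) : ℤ) - (l + 1 : ℕ) by push_cast; ring,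
        wordQC_comm] at this
      simpa [List.replicate_succ] using this
    | zero =>
      simp only [List.replicate_zero, List.nil_append, Nat.cast_zero, sub_zero]
      refine qc_of_finsetLT ?_ ?_
      · intro i hi j hj
        obtain ⟨x, hx⟩ := mem_sndSet.1 hi
        obtain ⟨y, hy⟩ := mem_fstSet.1 hj
        simp only [List.getElem?_append, List.length_replicate, List.getElem?_replicate] at hx hy
        grind
      · intro i hi j hj
        obtain ⟨x, hx⟩ := mem_fstSet.1 hi
        obtain ⟨y, hy⟩ := mem_sndSet.1 hj
        simp only [List.getElem?_append, List.length_replicate, List.getElem?_replicate] at hx hy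
        grind

theorem eq_replicate_append_of_pairwise {α : Type} [BEq α] [LawfulBEq α] {x y : α} (hxy : x ≠ y)
    {l : List α} (h : ∀ z ∈ l, z = x ∨ z = y) (hl : l.Pairwise fun s t => ¬ (s = y ∧ t = x)) :
    l = List.replicate (l.count x) x ++ List.replicate (l.count y) y := by
  induction l with
  | nil => simp
  | cons z l ih =>
    have ih := ih (fun t ht => h t (by simp [ht])) hl.of_cons
    rcases h z (by simp) with rfl | rfl
    · simp only [List.count_cons_self, List.count_cons_of_ne hxy, List.replicate_succ,
        List.cons_append, List.cons.injEq, true_and]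
      exact ih
    · have h0 : l.count x = 0 := by
        rw [List.count_eq_zero]
        intro hx
        exact List.rel_of_pairwise_cons hl hx ⟨rfl, rfl⟩
      rw [h0] at ih
      simp only [List.count_cons_of_ne hxy.symm, List.count_cons_self, h0, List.replicate_zero,
        List.nil_append, List.replicate_succ, List.cons.injEq, true_and]
      simpa using ih

theorem filter_wordOf_of_finsetLT {N : ℕ} {I I' : Finset ℕ} (hN : I ∪ I' ⊆ Finset.range N)
    (h : finsetLT (I' \ I) (I \ I')) : (wordOf N I I').filter Mixed =
      List.replicate (I' \ I).card (false, true) ++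
        List.replicate (I \ I').card (true, false) := by
  rw [← count_fst_wordOf hN, ← count_snd_wordOf hN]
  have := eq_replicate_append_of_pairwise (x := ((false, true) : Letter)) (y := (true, false))
    (by simp) (l := (wordOf N I I').filter Mixed) ?_ ?_
  · rwa [List.count_filter rfl, List.count_filter rfl] at this
  · rintro ⟨_ | _, _ | _⟩ hz <;> simp [Mixed] at hz ⊢
  · refine List.Pairwise.sublist List.filter_sublist ?_
    rw [wordOf, List.pairwise_map]
    refine List.pairwise_lt_range.imp fun {a b} hab hc => ?_
    simp only [Prod.mk.injEq, decide_eq_true_eq, decide_eq_false_iff_not] at hc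
    exact absurd (h b (by simp [hc]) a (by simp [hc])) (by omega)

theorem filter_wordOf_of_finsetLT' {N : ℕ} {I I' : Finset ℕ} (hN : I ∪ I' ⊆ Finset.range N)
    (h : finsetLT (I \ I') (I' \ I)) : (wordOf N I I').filter Mixed =
      List.replicate (I \ I').card (true, false) ++
        List.replicate (I' \ I).card (false, true) := by
  rw [← count_fst_wordOf hN, ← count_snd_wordOf hN]
  have := eq_replicate_append_of_pairwise (x := ((true, false) : Letter)) (y := (false, true))
    (by simp) (l := (wordOf N I I').filter Mixed) ?_ ?_
  · rwa [List.count_filter rfl, List.count_filter rfl] at this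
  · rintro ⟨_ | _, _ | _⟩ hz <;> simp [Mixed] at hz ⊢
  · refine List.Pairwise.sublist List.filter_sublist ?_
    rw [wordOf, List.pairwise_map]
    refine List.pairwise_lt_range.imp fun {a b} hab hc => ?_
    simp only [Prod.mk.injEq, decide_eq_true_eq, decide_eq_false_iff_not] at hc
    exact absurd (h b (by simp [hc]) a (by simp [hc])) (by omega)

/-- The quasicommutation of two minors whose row differences and column differences are
separated in opposite directions. -/
theorem qc_of_separated (hq : q ≠ 0) {I J I' J' : Finset ℕ} (hIJ : I.card = J.card)
    (hIJ' : I'.card = J'.card) (h : finsetLT (I' \ I) (I \ I')) (h' : finsetLT (J \ J') (J' \ J)) :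
    QC q I J I' J' ((I ∩ I').card - (J ∩ J').card) := by
  obtain ⟨N, hN⟩ : ∃ N, (I ∪ I') ∪ (J ∪ J') ⊆ Finset.range N :=
    ⟨((I ∪ I') ∪ (J ∪ J')).sup id + 1, Finset.subset_range_sup_succ _⟩
  rw [Finset.union_subset_iff] at hN
  obtain ⟨hM, hN⟩ := hN
  have hM' := Finset.union_subset_iff.1 hM
  have hN' := Finset.union_subset_iff.1 hN
  rw [← wordQC_wordOf hM'.1 hM'.2 hN'.1 hN'.2, wordQC_normalize hq,
    filter_wordOf_of_finsetLT hM h, filter_wordOf_of_finsetLT' hN h', count_both_wordOf hM,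
    count_both_wordOf hN]
  have h1 := Finset.card_inter_add_card_sdiff I I'
  have h2 := Finset.card_inter_add_card_sdiff I' I
  have h3 := Finset.card_inter_add_card_sdiff J J'
  have h4 := Finset.card_inter_add_card_sdiff J' J
  rw [Finset.inter_comm] at h2 h4
  exact wordQC_blocks hq _ _ _ _ _ _ (by omega) (by omega)

/-- Laplace expansion of a minor along a splitting of its column set. -/
theorem qMinor_split {A : Type} [Ring A] [Algebra K A] {x : ℕ → ℕ → A} (hx : FullQ q x)
    (I P Q : Finset ℕ) (h : finsetLT P Q) :
    qMinor q x I (P ∪ Q) = ∑ B ∈ I.powerset,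
      ((-q) ^ (((I \ B) ×ˢ B).filter (fun p => p.2 < p.1)).card) •
        (qMinor q x (I \ B) P * qMinor q x B Q) := by
  have e : (P ∪ Q).sort = P.sort ++ Q.sort := by
    have hp : (P.sort ++ Q.sort).Pairwise (· < ·) := by
      rw [List.pairwise_append]
      refine ⟨Finset.sortedLT_sort P |>.pairwise, Finset.sortedLT_sort Q |>.pairwise, ?_⟩
      intro a ha b hb
      exact h a (by simpa using ha) b (by simpa using hb)
    rw [← (List.toFinset_sort (· ≤ ·) (hp.imp ne_of_lt)).2 (hp.imp le_of_lt)]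
    congr 1
    ext i
    simp
  rw [qMinor_transpose hx, qMinor_eq_rowMinor, e, List.map_append, rowMinor_append]
  refine Finset.sum_congr rfl fun B _ => ?_
  rw [qMinor_transpose hx, qMinor_transpose hx, qMinor_eq_rowMinor, qMinor_eq_rowMinor]

/-- The quasicommutation of two minors with nested row sets. -/
theorem qc_of_subset (hq : q ≠ 0) {I J I' J' : Finset ℕ} (hIJ : I.card = J.card)
    (hI : I' ⊆ I) (hJ : WShalf J J') : ∃ c, QC q I J I' J' c := by
  classical
  obtain ⟨-, J₁, J₂, -, hU, h1, h2⟩ := hJ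
  set P := J'.filter fun j => ∀ a ∈ J \ J', j < a with hP
  set Q := J'.filter fun j => ¬ ∀ a ∈ J \ J', j < a with hQ
  have hPQ : P ∪ Q = J' := Finset.filter_union_filter_not_eq _ _
  have hlt : finsetLT P Q := by
    intro a ha b hb
    simp only [hP, hQ, Finset.mem_filter, not_forall, not_lt] at ha hb
    obtain ⟨-, c, hc, hbc⟩ := hb
    exact (ha.2 c hc).trans_le hbc
  have hP' : finsetLT (P \ J) (J \ P) := by
    intro a ha b hb
    rw [Finset.mem_sdiff] at ha hb
    by_cases hbJ : b ∈ J'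
    · refine hlt a ha.1 b ?_
      rw [← hPQ, Finset.mem_union] at hbJ
      exact hbJ.resolve_left hb.2
    · exact (Finset.mem_filter.1 ha.1).2 b (Finset.mem_sdiff.2 ⟨hb.1, hbJ⟩)
  have hQ' : finsetLT (J \ Q) (Q \ J) := by
    intro b hb a ha
    rw [Finset.mem_sdiff] at ha hb
    by_cases hbJ : b ∈ J'
    · refine hlt b ?_ a ha.1
      rw [← hPQ, Finset.mem_union] at hbJ
      exact hbJ.resolve_right hb.2
    · have ha1 := Finset.mem_filter.1 ha.1
      have haU : a ∈ J₁ ∪ J₂ := by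
        rw [hU]
        exact Finset.mem_sdiff.2 ⟨ha1.1, ha.2⟩
      rcases Finset.mem_union.1 haU with haU | haU
      · exact absurd (h1 a haU) ha1.2
      · exact h2 b (Finset.mem_sdiff.2 ⟨hb.1, hbJ⟩) a haU
  refine ⟨-((P.card : ℤ) - (P ∩ J).card) + (Q.card - (J ∩ Q).card), ?_⟩
  intro A _ _ x hx
  rw [← hPQ, qMinor_split hx _ _ _ hlt]
  simp only [Finset.mul_sum, Finset.sum_mul, Finset.smul_sum]
  refine Finset.sum_congr rfl fun B hB => ?_
  rw [Finset.mem_powerset] at hB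
  by_cases hcP : (I' \ B).card = P.card
  · by_cases hcQ : B.card = Q.card
    · have e1 := (qc_of_separated (q := q) hq hcP hIJ (I := I' \ B) (I' := I) (J := P) (J' := J)
        (by
          have : (I' \ B) \ I = ∅ :=
            Finset.sdiff_eq_empty_iff_subset.2 (Finset.sdiff_subset.trans hI)
          intro a _ b hb
          simp [this] at hb) hP').symm hq A x hx
      have e2 := qc_of_separated (q := q) hq hIJ hcQ (I := I) (I' := B) (J := J) (J' := Q)
        (by
          have : B \ I = ∅ := Finset.sdiff_eq_empty_iff_subset.2 (hB.trans hI)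
          intro a ha
          simp [this] at ha) hQ' A x hx
      rw [Finset.inter_eq_left.2 (Finset.sdiff_subset.trans hI), hcP] at e1
      rw [Finset.inter_eq_right.2 (hB.trans hI), hcQ] at e2
      rw [mul_smul_comm, smul_mul_assoc, smul_comm (q ^ (_ : ℤ)), ← mul_assoc, e1, smul_mul_assoc,
        mul_assoc, e2, mul_smul_comm, zpow_add₀ hq]
      simp only [smul_smul, mul_assoc]
    · rw [qMinor, qMinor, qMinor, dif_neg hcQ]
      simp
  · rw [qMinor, qMinor, dif_neg hcP]
    simp

end Normalize

section SignedLists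

theorem sublist_delete_two {α : Type} (p s : List α) (x y : α) :
    (p ++ s).Sublist (p ++ x :: y :: s) :=
  (List.Sublist.refl p).append
    ((List.sublist_cons_self y s).trans (List.sublist_cons_self x _))

variable {α : Type} (ε : α → Bool)

/-- A signed list with as many positive as negative elements. -/
def Balanced (t : List α) : Prop := t.countP ε = t.countP fun x => !ε x

/-- The list has a sublist of four elements of alternating signs. -/
def Alt4 (t : List α) : Prop :=
  ∃ a b c d, [a, b, c, d].Sublist t ∧ ε a ≠ ε b ∧ ε b ≠ ε c ∧ ε c ≠ ε d

/-- The list `t'` arises from `t` by deleting two adjacent elements of opposite signs. -/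
def Step (t t' : List α) : Prop :=
  ∃ p x y s, ε x ≠ ε y ∧ t = p ++ x :: y :: s ∧ t' = p ++ s

variable {ε}

theorem Balanced.of_append {p s : List α} {x y : α} (h : Balanced ε (p ++ x :: y :: s))
    (hxy : ε x ≠ ε y) : Balanced ε (p ++ s) := by
  simp only [Balanced, List.countP_append, List.countP_cons] at h ⊢
  cases hx : ε x <;> cases hy : ε y <;> simp [hx, hy] at h hxy <;> omega

theorem Balanced.step {t t' : List α} (h : Balanced ε t) (hs : Step ε t t') : Balanced ε t' := by
  obtain ⟨p, x, y, s, hxy, rfl, rfl⟩ := hs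
  exact h.of_append hxy

theorem Step.sublist {t t' : List α} (hs : Step ε t t') : t'.Sublist t := by
  obtain ⟨p, x, y, s, hxy, rfl, rfl⟩ := hs
  exact sublist_delete_two p s x y

theorem exists_adjacent {t : List α} {a b : α} (ha : a ∈ t) (hb : b ∈ t) (hab : ε a ≠ ε b) :
    ∃ p x y s, ε x ≠ ε y ∧ t = p ++ x :: y :: s := by
  suffices h : ∀ (t : List α) (z : α), (∃ w ∈ t, ε z ≠ ε w) →
      ∃ p x y s, ε x ≠ ε y ∧ z :: t = p ++ x :: y :: s by
    cases t with
    | nil => simp at ha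
    | cons z t =>
      apply h
      by_contra! hz
      have : ∀ w ∈ z :: t, ε w = ε z := by
        intro w hw
        rcases List.mem_cons.1 hw with rfl | hw
        exacts [rfl, (hz w hw).symm]
      exact hab ((this a ha).trans (this b hb).symm)
  intro t
  induction t with
  | nil => simp
  | cons y t ih =>
    intro z hz
    by_cases hzy : ε z = ε y
    · obtain ⟨w, hw, hzw⟩ := hz
      have hw' : w ∈ t := by
        rcases List.mem_cons.1 hw with rfl | hw
        exacts [absurd hzy hzw, hw]
      obtain ⟨p, x, x', s, hx, e⟩ := ih y ⟨w, hw', hzy ▸ hzw⟩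
      exact ⟨z :: p, x, x', s, hx, by rw [e]; rfl⟩
    · exact ⟨[], z, y, t, hzy, rfl⟩

theorem Balanced.exists_ne {p s : List α} {a : α} (h : Balanced ε (p ++ a :: s)) :
    ∃ b ∈ p ++ s, ε b ≠ ε a := by
  by_contra! hc
  simp only [List.mem_append] at hc
  simp only [Balanced, List.countP_append, List.countP_cons] at h
  have hp : ∀ b ∈ p, ε b = ε a := fun b hb => hc b (.inl hb)
  have hs : ∀ b ∈ s, ε b = ε a := fun b hb => hc b (.inr hb)
  cases ha : ε a
  · have hp' : p.countP ε = 0 := List.countP_eq_zero.2 fun b hb => by simp [hp b hb, ha]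
    have hs' : s.countP ε = 0 := List.countP_eq_zero.2 fun b hb => by simp [hs b hb, ha]
    simp [ha, hp', hs'] at h
  · have hp' : (p.countP fun x => !ε x) = 0 :=
      List.countP_eq_zero.2 fun b hb => by simp [hp b hb, ha]
    have hs' : (s.countP fun x => !ε x) = 0 :=
      List.countP_eq_zero.2 fun b hb => by simp [hs b hb, ha]
    simp [ha, hp', hs'] at h

theorem Balanced.exists_adjacent {t : List α} (h : Balanced ε t) (ht : t ≠ []) :
    ∃ p x y s, ε x ≠ ε y ∧ t = p ++ x :: y :: s := by
  obtain ⟨a, t, rfl⟩ := List.exists_cons_of_ne_nil ht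
  obtain ⟨b, hb, hba⟩ := Balanced.exists_ne (p := []) h
  exact QuasiCommute.exists_adjacent (a := b) (b := a) (List.mem_cons_of_mem _ hb)
    List.mem_cons_self hba

/-- A list with a sublist of four elements of alternating signs can be reduced to a list with
three consecutive elements of alternating signs. -/
theorem Alt4.exists_consecutive {t : List α} (h : Alt4 ε t) :
    ∃ p x y z s, Relation.ReflTransGen (Step ε) t (p ++ x :: y :: z :: s) ∧
      ε x ≠ ε y ∧ ε y ≠ ε z := by
  obtain ⟨x, b', c', y, hsub, hxb, hbc, hcy⟩ := h
  have hform : ∃ p a b s, t = p ++ a :: b :: s ∧ ε a ≠ ε b ∧ (∃ x ∈ p, ε x = ε b) ∧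
      ∃ y ∈ s, ε y = ε a := by
    obtain ⟨p₁, t₁, rfl, hp₁, h₁⟩ := List.cons_sublist_iff.1 hsub
    obtain ⟨p₂, t₂, rfl, hp₂, h₂⟩ := List.cons_sublist_iff.1 h₁
    obtain ⟨p₃, t₃, rfl, hp₃, h₃⟩ := List.cons_sublist_iff.1 h₂
    obtain ⟨p₄, q₄, rfl⟩ := List.append_of_mem hp₂
    obtain ⟨p₅, q₅, rfl⟩ := List.append_of_mem hp₃
    rw [List.singleton_sublist] at h₃
    suffices key : ∀ (l : List α) (P : List α) (b : α), (∃ x ∈ P, ε x ≠ ε b) → ε b ≠ ε c' →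
        ∃ p a b₁ s, P ++ b :: (l ++ c' :: (q₅ ++ t₃)) = p ++ a :: b₁ :: s ∧ ε a ≠ ε b₁ ∧
          (∃ x ∈ p, ε x = ε b₁) ∧ ∃ y ∈ s, ε y = ε a by
      obtain ⟨p, a, b, s, e, h⟩ := key (q₄ ++ p₅) (p₁ ++ p₄) b' ⟨x, by simp [hp₁], hxb⟩ hbc
      exact ⟨p, a, b, s, by simpa using e, h⟩
    intro l
    induction l with
    | nil =>
      rintro P b ⟨x, hx, hxb⟩ hb
      refine ⟨P, b, c', q₅ ++ t₃, rfl, hb, ⟨x, hx, ?_⟩, y, by simp [h₃], ?_⟩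
      · revert hxb hb; cases ε x <;> cases ε b <;> cases ε c' <;> simp
      · revert hcy hb; cases ε y <;> cases ε b <;> cases ε c' <;> simp
    | cons d l ih =>
      rintro P b ⟨x, hx, hxb⟩ hb
      by_cases hbd : ε b = ε d
      · obtain ⟨p, a, b₁, s, e, h⟩ := ih (P ++ [b]) d ⟨x, by simp [hx], hbd ▸ hxb⟩ (hbd ▸ hb)
        exact ⟨p, a, b₁, s, by simpa using e, h⟩
      · refine ⟨P, b, d, l ++ c' :: (q₅ ++ t₃), rfl, hbd, ⟨x, hx, ?_⟩, y, by simp [h₃], ?_⟩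
        · revert hxb hbd; cases ε x <;> cases ε b <;> cases ε d <;> simp
        · revert hcy hb; cases ε y <;> cases ε b <;> cases ε c' <;> simp
  obtain ⟨p, a, b, s, rfl, hab, hx, hy⟩ := hform
  clear hsub hxb hbc hcy
  induction p using List.reverseRecOn generalizing a b s with
  | nil => simp at hx
  | append_singleton p l ih =>
    by_cases hl : ε l = ε a
    · obtain ⟨y, hy, hya⟩ := hy
      obtain ⟨h, s, rfl⟩ := List.exists_cons_of_ne_nil (List.ne_nil_of_mem hy)
      by_cases hh : ε h = ε b
      · have hx' : ∃ x ∈ p, ε x = ε h := by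
          obtain ⟨x, hx, hxb⟩ := hx
          rcases List.mem_append.1 hx with hx | hx
          · exact ⟨x, hx, hxb.trans hh.symm⟩
          · rw [List.mem_singleton] at hx
            subst hx
            exact absurd (hl.symm.trans hxb) hab
        have hy' : ∃ y ∈ s, ε y = ε l := by
          rcases List.mem_cons.1 hy with rfl | hy
          · exact absurd (hya.symm.trans hh) hab
          · exact ⟨y, hy, hya.trans hl.symm⟩
        obtain ⟨P, x, y', z, S, hr, hxy, hyz⟩ := ih l h s (hl ▸ hh ▸ hab) hx' hy'
        refine ⟨P, x, y', z, S, Relation.ReflTransGen.head ?_ hr, hxy, hyz⟩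
        exact ⟨p ++ [l], a, b, h :: s, hab, rfl, by simp⟩
      · exact ⟨p ++ [l], a, b, h, s, .refl, hab, fun h => hh h.symm⟩
    · exact ⟨p, l, a, b, s, by simpa using Relation.ReflTransGen.refl, hl, hab⟩

end SignedLists

section Corner

variable {K : Type} [Field K] {A : Type} [Ring A] [Algebra K A]

theorem qMinor_congr (q : K) {x y : ℕ → ℕ → A} {I J : Finset ℕ}
    (h : ∀ i ∈ I, ∀ j ∈ J, x i j = y i j) : qMinor q x I J = qMinor q y I J := by
  unfold qMinor
  split_ifs with hc
  · simp only [h _ (Finset.orderEmbOfFin_mem I rfl _) _ (Finset.orderEmbOfFin_mem J hc.symm _)]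
  · rfl

/-- The matrix `x` cut down to the first `M` rows and `N` columns and extended by a
diagonal entry `1` at position `(M, N)`. -/
def bordered (M N : ℕ) (x : ℕ → ℕ → A) (i j : ℕ) : A :=
  if i < M ∧ j < N then x i j else if i = M ∧ j = N then 1 else 0

theorem bordered_of_lt {M N i j : ℕ} (x : ℕ → ℕ → A) (hi : i < M) (hj : j < N) :
    bordered M N x i j = x i j := if_pos ⟨hi, hj⟩

theorem bordered_self {M N : ℕ} (x : ℕ → ℕ → A) : bordered M N x M N = 1 := by
  simp [bordered]

theorem bordered_left {M N i : ℕ} (x : ℕ → ℕ → A) (hi : i ≠ M) : bordered M N x i N = 0 := by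
  simp [bordered, hi]

theorem bordered_right {M N j : ℕ} (x : ℕ → ℕ → A) (hj : j ≠ N) : bordered M N x M j = 0 := by
  simp [bordered, hj]

theorem bordered_row_gt {M N i : ℕ} (x : ℕ → ℕ → A) (hi : M < i) (j : ℕ) :
    bordered M N x i j = 0 := by
  simp [bordered, hi.ne', hi.not_gt]

theorem bordered_col_gt {M N j : ℕ} (x : ℕ → ℕ → A) (hj : N < j) (i : ℕ) :
    bordered M N x i j = 0 := by
  simp [bordered, hj.ne', hj.not_gt]

theorem FullQ.bordered {q : K} {x : ℕ → ℕ → A} (hx : FullQ q x) (M N : ℕ) :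
    FullQ q (bordered M N x) := by
  refine ⟨fun i j k hjk => ?_, fun i l hil => ⟨fun j => ?_, fun j k hjk => ?_, fun j k hjk => ?_⟩⟩
  · rcases lt_trichotomy i M with hi | rfl | hi
    · rcases lt_trichotomy k N with hk | rfl | hk
      · rw [bordered_of_lt x hi hk, bordered_of_lt x hi (hjk.trans hk)]
        exact hx.1 i j k hjk
      · simp [bordered_left x hi.ne]
      · simp [bordered_col_gt x hk]
    · by_cases hj : j = N
      · subst hj
        simp [bordered_right x hjk.ne']
      · simp [bordered_right x hj]
    · simp [bordered_row_gt x hi]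
  · rcases lt_trichotomy l M with hl | rfl | hl
    · rcases lt_trichotomy j N with hj | rfl | hj
      · rw [bordered_of_lt x hl hj, bordered_of_lt x (hil.trans hl) hj]
        exact (hx.2 i l hil).col j
      · simp [bordered_left x hl.ne]
      · simp [bordered_col_gt x hj]
    · by_cases hj : j = N
      · subst hj
        simp [bordered_left x hil.ne]
      · simp [bordered_right x hj]
    · simp [bordered_row_gt x hl]
  · rcases lt_trichotomy l M with hl | rfl | hl
    · rcases lt_trichotomy k N with hk | rfl | hk
      · rw [bordered_of_lt x hl (hjk.trans hk), bordered_of_lt x (hil.trans hl) hk]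
        exact (hx.2 i l hil).anti j k hjk
      · simp [bordered_left x (hil.trans hl).ne]
      · simp [bordered_col_gt x hk]
    · by_cases hj : j = N
      · subst hj
        simp [bordered_self]
      · simp [bordered_right x hj]
    · simp [bordered_row_gt x hl]
  · rcases lt_trichotomy l M with hl | rfl | hl
    · rcases lt_trichotomy k N with hk | rfl | hk
      · rw [bordered_of_lt x hl (hjk.trans hk), bordered_of_lt x (hil.trans hl) hk,
          bordered_of_lt x hl hk, bordered_of_lt x (hil.trans hl) (hjk.trans hk)]
        exact (hx.2 i l hil).diag j k hjk
      · simp [bordered_left x (hil.trans hl).ne, bordered_left x hl.ne]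
      · simp [bordered_col_gt x hk]
    · rcases lt_trichotomy k N with hk | rfl | hk
      · simp [bordered_right x hk.ne, bordered_right x (hjk.trans hk).ne]
      · simp [bordered_self, bordered_left x hil.ne]
      · simp [bordered_col_gt x hk]
    · simp [bordered_row_gt x hl]

theorem rowMinor_singleton (q : K) (ρ : ℕ → A) (J : Finset ℕ) :
    rowMinor q [ρ] J = ∑ j ∈ J, if J = {j} then ρ j else 0 := by
  rw [rowMinor]
  refine Finset.sum_congr rfl fun j hj => ?_
  rw [rowMinor]
  by_cases h : J = {j}
  · subst h
    simp [Finset.filter_singleton]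
  · rw [if_neg h, if_neg, mul_zero, smul_zero]
    rwa [Finset.erase_eq_empty_iff, not_or, and_iff_right (Finset.ne_empty_of_mem hj)]

theorem sort_insert_of_lt {M : ℕ} {I : Finset ℕ} (h : ∀ i ∈ I, i < M) :
    (insert M I).sort = I.sort ++ [M] := by
  have hp : (I.sort ++ [M]).Pairwise (· < ·) := by
    refine List.pairwise_append.2
      ⟨Finset.sortedLT_sort I |>.pairwise, List.pairwise_singleton _ _, ?_⟩
    intro a ha b hb
    rw [List.mem_singleton] at hb
    exact hb ▸ h a ((Finset.mem_sort _).1 ha)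
  have e : (I.sort ++ [M]).toFinset = insert M I := by
    ext; simp
  rw [← e]
  exact (List.toFinset_sort _ (hp.imp ne_of_lt)).2 (hp.imp le_of_lt)

theorem qMinor_bordered (q : K) {M N : ℕ} {I J : Finset ℕ} (hI : ∀ i ∈ I, i < M)
    (hJ : ∀ j ∈ J, j < N) (x : ℕ → ℕ → A) :
    qMinor q (bordered M N x) (insert M I) (insert N J) = qMinor q x I J := by
  have hN : N ∉ J := fun h => (hJ N h).false
  rw [qMinor_congr q (x := x) (y := bordered M N x)
    fun i hi j hj => (bordered_of_lt x (hI i hi) (hJ j hj)).symm]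
  rw [qMinor_eq_rowMinor, qMinor_eq_rowMinor, sort_insert_of_lt hI, List.map_append,
    List.map_singleton, rowMinor_append, Finset.sum_eq_single {N}]
  · have h₁ : insert N J \ {N} = J := by
      rw [Finset.insert_sdiff_of_mem _ (Finset.mem_singleton_self N)]
      simp [hN]
    have h₂ : (J ×ˢ {N}).filter (fun p : ℕ × ℕ => p.2 < p.1) = ∅ := by
      rw [Finset.filter_eq_empty_iff]
      rintro ⟨a, b⟩ hab
      simp only [Finset.mem_product, Finset.mem_singleton] at hab
      have := hJ a hab.1
      simp only [hab.2]
      omega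
    rw [h₁, h₂, rowMinor_singleton]
    simp [bordered_self]
  · intro B hB hne
    rw [rowMinor_singleton, Finset.sum_eq_zero, mul_zero, smul_zero]
    intro j hj
    split_ifs with h
    · exact bordered_right x fun hjN => hne (by rw [h, hjN])
    · rfl
  · simp

theorem QC.corner {q : K} {M N : ℕ} {I J I' J' : Finset ℕ} {c : ℤ} (hI : ∀ i ∈ I, i < M)
    (hJ : ∀ j ∈ J, j < N) (hI' : ∀ i ∈ I', i < M) (hJ' : ∀ j ∈ J', j < N)
    (h : QC q (insert M I) (insert N J) I' J' c) : QC q I J I' J' c := by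
  intro A _ _ x hx
  have := h A _ (hx.bordered M N)
  rwa [qMinor_bordered q hI hJ, qMinor_congr q (x := bordered M N x) (y := x) (I := I')
    fun i hi j hj => bordered_of_lt x (hI' i hi) (hJ' j hj)] at this

theorem fstSet_lt {w : List Letter} : ∀ i ∈ fstSet w, i < w.length := by
  intro i hi
  obtain ⟨b, hb⟩ := mem_fstSet.1 hi
  exact (List.getElem?_eq_some_iff.1 hb).1

theorem sndSet_lt {w : List Letter} : ∀ i ∈ sndSet w, i < w.length := by
  intro i hi
  obtain ⟨b, hb⟩ := mem_sndSet.1 hi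
  exact (List.getElem?_eq_some_iff.1 hb).1

theorem fstSet_concat (w : List Letter) (b b' : Bool) :
    fstSet (w ++ [(b, b')]) = if b then insert w.length (fstSet w) else fstSet w := by
  simp only [fstSet, labelled, List.zipIdx_append, upper]
  ext i
  cases b <;> simp

theorem sndSet_concat (w : List Letter) (b b' : Bool) :
    sndSet (w ++ [(b, b')]) = if b' then insert w.length (sndSet w) else sndSet w := by
  simp only [sndSet, labelled, List.zipIdx_append, lower]
  ext i
  cases b' <;> simp

theorem WordQC.corner {q : K} (hq : q ≠ 0) {u v : List Letter} {b : Bool} {c : ℤ}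
    (h : WordQC q (u ++ [(b, !b)]) (v ++ [(b, !b)]) c) : WordQC q u v c := by
  rw [WordQC, fstSet_concat, fstSet_concat, sndSet_concat, sndSet_concat] at h
  cases b
  · simpa [WordQC] using (QC.corner sndSet_lt sndSet_lt fstSet_lt fstSet_lt (h.symm hq)).symm hq
  · exact QC.corner fstSet_lt fstSet_lt sndSet_lt sndSet_lt h

theorem fullQ_one (q : K) : FullQ q (fun i j => if i = j then (1 : K) else 0) := by
  refine ⟨fun i j k hjk => ?_, fun i l hil => ⟨fun j => ?_, fun j k hjk => ?_, fun j k hjk => ?_⟩⟩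
  · by_cases h : i = j
    · simp [h, hjk.ne]
    · simp [h]
  · by_cases h : i = j
    · simp [← h, hil.ne']
    · simp [h]
  · ring
  · by_cases h : i = k
    · have : l ≠ j := by omega
      simp [this, mul_comm]
    · simp [h, mul_comm]

theorem qMinor_one (q : K) (I : Finset ℕ) :
    qMinor q (fun i j => if i = j then (1 : K) else 0) I I = 1 := by
  rw [qMinor, dif_pos rfl, Finset.sum_eq_single 1]
  · have : permInversions (1 : Equiv.Perm (Fin I.card)) = 0 := by
      rw [permInversions, Finset.card_eq_zero, Finset.filter_eq_empty_iff]
      rintro ⟨a, b⟩ -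
      simp only [Equiv.Perm.coe_one, id, not_and, not_lt]
      exact le_of_lt
    rw [this, List.prod_ofFn]
    simp
  · intro σ _ hσ
    obtain ⟨d, hd⟩ := not_forall.1 fun h => hσ (Equiv.ext h)
    rw [List.prod_ofFn, Finset.prod_eq_zero (Finset.mem_univ d), smul_zero]
    rw [if_neg]
    intro h
    exact hd ((I.orderEmbOfFin rfl).injective h).symm
  · simp

end Corner

section Tokens

/-- A row (`true`) or a column (`false`) together with a sign. -/
abbrev Token := Bool × Bool

/-- The word of the rows of a list of tokens. -/
def rowWord (t : List Token) : List Letter := (t.filter fun a => a.1).map fun a => (a.2, !a.2)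

/-- The word of the columns of a list of tokens, which lists them from right to left. -/
def colWord (t : List Token) : List Letter :=
  ((t.filter fun a => !a.1).map fun a => (!a.2, a.2)).reverse

/-- All rows precede all columns. -/
def RowsFirst (t : List Token) : Prop := t.Pairwise fun a b => a.1 = false → b.1 = false

theorem rowWord_append (t t' : List Token) : rowWord (t ++ t') = rowWord t ++ rowWord t' := by
  simp [rowWord]

theorem colWord_append (t t' : List Token) : colWord (t ++ t') = colWord t' ++ colWord t := by
  simp [colWord]

theorem rowWord_cons (a : Token) (t : List Token) :
    rowWord (a :: t) = if a.1 then (a.2, !a.2) :: rowWord t else rowWord t := by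
  rcases a with ⟨_ | _, _⟩ <;> simp [rowWord]

theorem colWord_cons (a : Token) (t : List Token) :
    colWord (a :: t) = if a.1 then colWord t else colWord t ++ [(!a.2, a.2)] := by
  rcases a with ⟨_ | _, _⟩ <;> simp [colWord]

theorem rowWord_eq_nil {t : List Token} (h : ∀ a ∈ t, a.1 = false) : rowWord t = [] := by
  simpa [rowWord] using h

theorem colWord_eq_nil {t : List Token} (h : ∀ a ∈ t, a.1 = true) : colWord t = [] := by
  simpa [colWord] using h

variable {K : Type} [Field K] {q : K}

/-- Quasicommutation of two minors whose symmetric differences are described by `t`. -/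
def TokenQC (q : K) (t : List Token) (c : ℤ) : Prop :=
  ∃ k l, k + (rowWord t).count (true, false) = l + (colWord t).count (true, false) ∧
    WordQC q (List.replicate k (true, true) ++ rowWord t)
      (List.replicate l (true, true) ++ colWord t) c

/-- The sign of a token. -/
def sgn (b : Bool) : ℤ := if b then 1 else -1

/-- The change of the exponent under deletion of two adjacent tokens. -/
def defect (x y : Token) : ℤ := if x.1 = y.1 then sgn x.2 else 0

theorem TokenQC.step (hq : q ≠ 0) {p s : List Token} {x y : Token} {c : ℤ}
    (hs : RowsFirst (p ++ x :: y :: s)) (hxy : x.2 ≠ y.2) (h : TokenQC q (p ++ x :: y :: s) c) :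
    TokenQC q (p ++ s) (c - defect x y) := by
  obtain ⟨k, l, hkl, h⟩ := h
  obtain ⟨x₁, b⟩ := x
  obtain ⟨y₁, b'⟩ := y
  obtain rfl : b' = !b := by revert hxy; cases b <;> cases b' <;> simp
  simp only [RowsFirst, List.pairwise_append, List.pairwise_cons, List.mem_cons] at hs
  obtain ⟨-, ⟨hx, hy, -⟩, hp⟩ := hs
  rw [rowWord_append, colWord_append, rowWord_cons, rowWord_cons, colWord_cons,
    colWord_cons] at h hkl
  have hc : c - -1 = c + 1 := by ring
  cases x₁ <;> cases y₁
  · simp only [Bool.false_eq_true, if_false, Bool.not_not] at h hkl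
    rw [wordQC_comm] at h
    refine ⟨k, l + 1, ?_, ?_⟩
    · rw [rowWord_append, colWord_append]
      cases b <;> simp [List.count_append] at hkl ⊢ <;> omega
    · rw [rowWord_append, colWord_append, wordQC_comm, List.replicate_succ]
      cases b
      · have := wordQC_contract hq (w₁ := List.replicate l (true, true) ++ colWord s)
          (w₂ := colWord p) (by simpa using h)
        simpa [defect, sgn, hc] using this
      · have := wordQC_contract' hq (w₁ := List.replicate l (true, true) ++ colWord s)
          (w₂ := colWord p) (by simpa using h)
        simpa [defect, sgn] using this
  · exact absurd (hx _ (.inl rfl) rfl) (by simp)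
  · have hp' : ∀ a ∈ p, a.1 = true := fun a ha => by
      by_contra hne
      exact absurd (hp a ha _ (.inl rfl) (by simpa using hne)) (by simp)
    have hs' : ∀ a ∈ s, a.1 = false := fun a ha => hy a ha rfl
    simp only [Bool.false_eq_true, if_false, if_true, Bool.not_not, rowWord_eq_nil hs',
      colWord_eq_nil hp'] at h hkl
    refine ⟨k, l, ?_, ?_⟩
    · rw [rowWord_append, colWord_append, rowWord_eq_nil hs', colWord_eq_nil hp']
      simp [List.count_append] at hkl ⊢
      omega
    · rw [rowWord_append, colWord_append, rowWord_eq_nil hs', colWord_eq_nil hp']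
      have := WordQC.corner hq (u := List.replicate k (true, true) ++ rowWord p)
        (v := List.replicate l (true, true) ++ colWord s) (b := b) (by simpa using h)
      simpa [defect] using this
  · simp only [if_true, Bool.not_not] at h hkl
    refine ⟨k + 1, l, ?_, ?_⟩
    · rw [rowWord_append, colWord_append]
      cases b <;> simp [List.count_append] at hkl ⊢ <;> omega
    · rw [rowWord_append, colWord_append, List.replicate_succ]
      cases b
      · have := wordQC_contract hq (w₁ := List.replicate k (true, true) ++ rowWord p)
          (w₂ := rowWord s) (by simpa using h)
        simpa [defect, sgn, hc] using this
      · have := wordQC_contract' hq (w₁ := List.replicate k (true, true) ++ rowWord p)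
          (w₂ := rowWord s) (by simpa using h)
        simpa [defect, sgn] using this

theorem fstSet_replicate (k : ℕ) : fstSet (List.replicate k (true, true)) = Finset.range k := by
  ext i
  rw [mem_fstSet]
  simp [List.getElem?_replicate]

theorem sndSet_replicate (k : ℕ) : sndSet (List.replicate k (true, true)) = Finset.range k := by
  ext i
  rw [mem_sndSet]
  simp [List.getElem?_replicate]

theorem TokenQC.eq_zero_of_nil (hroot : ∀ c : ℤ, q ^ c = 1 → c = 0) {c : ℤ}
    (h : TokenQC q [] c) : c = 0 := by
  obtain ⟨k, l, hkl, h⟩ := h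
  obtain rfl : k = l := by simpa [rowWord, colWord] using hkl
  have := h K _ (fullQ_one q)
  simp [rowWord, colWord, fstSet_replicate, sndSet_replicate, qMinor_one] at this
  exact hroot c this.symm

theorem RowsFirst.sublist {t t' : List Token} (h : RowsFirst t) (hs : t'.Sublist t) :
    RowsFirst t' := List.Pairwise.sublist hs h

theorem TokenQC.unique (hq : q ≠ 0) (hroot : ∀ c : ℤ, q ^ c = 1 → c = 0) {t : List Token}
    (hb : Balanced Prod.snd t) (hs : RowsFirst t) {c c' : ℤ} (h : TokenQC q t c)
    (h' : TokenQC q t c') : c = c' := by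
  induction hn : t.length using Nat.strong_induction_on generalizing t c c' with
  | _ n ih =>
    by_cases ht : t = []
    · subst ht
      rw [h.eq_zero_of_nil hroot, h'.eq_zero_of_nil hroot]
    · obtain ⟨p, x, y, s, hxy, rfl⟩ := hb.exists_adjacent ht
      have := ih _ (by simp [← hn]) (hb.of_append hxy) (hs.sublist (sublist_delete_two p s x y))
        (h.step hq hs hxy) (h'.step hq hs hxy) rfl
      linarith

/-- Interchanging a row and a column of the same sign in the middle of a list of tokens changes
the exponent. -/
theorem TokenQC.sub_eq (hq : q ≠ 0) (hroot : ∀ c : ℤ, q ^ c = 1 → c = 0) {p s : List Token}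
    {b : Bool} (hp : ∀ a ∈ p, a.1 = true) (hs : ∀ a ∈ s, a.1 = false)
    (hb : Balanced Prod.snd (p ++ (true, b) :: s)) {c c' : ℤ}
    (h : TokenQC q (p ++ (true, b) :: s) c) (h' : TokenQC q (p ++ (false, b) :: s) c') :
    c - c' = -sgn b := by
  have rowsFirst : ∀ (p s : List Token) (a : Bool), (∀ a ∈ p, a.1 = true) →
      (∀ a ∈ s, a.1 = false) → RowsFirst (p ++ (a, b) :: s) := by
    intro p s a hp hs
    refine List.pairwise_append.2 ⟨List.pairwise_of_forall_mem_list ?_, ?_, ?_⟩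
    · intro x hx y hy
      simp [hp x hx]
    · exact List.pairwise_cons.2 ⟨fun y hy _ => hs y hy,
        List.pairwise_of_forall_mem_list fun x _ y hy _ => hs y hy⟩
    · intro x hx y hy
      simp [hp x hx]
  have hsgn : ∀ b' : Bool, b' ≠ b → sgn b' = -sgn b := by
    intro b'
    cases b' <;> cases b <;> simp [sgn]
  induction hn : p.length + s.length using Nat.strong_induction_on generalizing p s c c' with
  | _ n ih =>
    have r := rowsFirst p s true hp hs
    have r' := rowsFirst p s false hp hs
    by_cases hlast : ∃ p' a, p = p' ++ [a] ∧ a.2 ≠ b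
    · obtain ⟨p', ⟨a₁, a₂⟩, rfl, ha⟩ := hlast
      obtain rfl : a₁ = true := hp (a₁, a₂) (by simp)
      simp only [List.append_assoc, List.singleton_append] at hb h h' r r'
      have := TokenQC.unique hq hroot (hb.of_append ha) (r.sublist (sublist_delete_two _ _ _ _))
        (h.step hq r ha) (h'.step hq r' ha)
      simp only [defect, if_true, hsgn _ ha, Bool.true_eq_false, if_false] at this
      linarith
    by_cases hhead : ∃ a s', s = a :: s' ∧ b ≠ a.2
    · obtain ⟨⟨a₁, a₂⟩, s', rfl, ha⟩ := hhead
      obtain rfl : a₁ = false := hs (a₁, a₂) (by simp)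
      have := TokenQC.unique hq hroot (hb.of_append ha) (r.sublist (sublist_delete_two _ _ _ _))
        (h.step hq r ha) (h'.step hq r' ha)
      simp only [defect, if_true, Bool.true_eq_false, if_false] at this
      linarith
    obtain ⟨a, ha, hab⟩ := hb.exists_ne
    rcases List.mem_append.1 ha with ha | ha
    · obtain ⟨p', d, rfl⟩ := List.eq_nil_or_concat' p |>.resolve_left (List.ne_nil_of_mem ha)
      have hd : d.2 = b := by
        by_contra hd
        exact hlast ⟨p', d, rfl, hd⟩
      obtain ⟨u, x, y, v, hxy, e⟩ := exists_adjacent (ε := Prod.snd) ha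
        (List.mem_append_right p' (List.mem_singleton_self d)) (by simpa [hd] using hab)
      rw [e] at hp hb h h' r r' hn
      simp only [List.append_assoc, List.cons_append] at hb h h' r r'
      have := ih (u.length + v.length + s.length) (by simp at hn; omega) (p := u ++ v) (s := s)
        (fun a ha => hp a ((sublist_delete_two u v x y).subset ha)) hs
        (by simpa using hb.of_append hxy) (by simpa using h.step hq r hxy)
        (by simpa using h'.step hq r' hxy) (by simp)
      linarith
    · obtain ⟨d, s', rfl⟩ := List.exists_cons_of_ne_nil (List.ne_nil_of_mem ha)
      have hd : d.2 = b := by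
        by_contra hd
        exact hhead ⟨d, s', rfl, fun h => hd h.symm⟩
      obtain ⟨u, x, y, v, hxy, e⟩ := exists_adjacent (ε := Prod.snd) ha
        (List.mem_cons_self (a := d) (l := s')) (by simpa [hd] using hab)
      rw [e] at hs hb h h' r r' hn
      have e' : ∀ a : Token, p ++ a :: (u ++ x :: y :: v) = (p ++ a :: u) ++ x :: y :: v := by simp
      rw [e'] at hb h h' r r'
      have := ih (p.length + (u ++ v).length) (by simp at hn ⊢; omega) (p := p) (s := u ++ v)
        hp (fun a ha => hs a ((sublist_delete_two u v x y).subset ha))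
        (by simpa using hb.of_append hxy) (by simpa using h.step hq r hxy)
        (by simpa using h'.step hq r' hxy) rfl
      linarith

theorem sgn_ne_zero (b : Bool) : sgn b ≠ 0 := by
  cases b <;> simp [sgn]

theorem TokenQC.not_alt4 (hq : q ≠ 0) (hroot : ∀ c : ℤ, q ^ c = 1 → c = 0) {t : List Token}
    (hb : Balanced Prod.snd t) (hs : RowsFirst t) {c : ℤ} (h : TokenQC q t c) :
    ¬ Alt4 Prod.snd t := by
  intro h4
  obtain ⟨p, x, y, z, s, hr, hxy, hyz⟩ := h4.exists_consecutive
  have key : ∀ t', Relation.ReflTransGen (Step Prod.snd) t t' →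
      Balanced Prod.snd t' ∧ RowsFirst t' ∧ ∃ c, TokenQC q t' c := by
    intro t' hr
    induction hr with
    | refl => exact ⟨hb, hs, c, h⟩
    | tail _ hst ih =>
      obtain ⟨hb, hs, c, h⟩ := ih
      refine ⟨hb.step hst, hs.sublist hst.sublist, ?_⟩
      obtain ⟨p, x, y, s, hxy, rfl, rfl⟩ := hst
      exact ⟨_, h.step hq hs hxy⟩
  obtain ⟨hb, hs, c, h⟩ := key _ hr
  have e : p ++ x :: y :: z :: s = (p ++ [x]) ++ y :: z :: s := by simp
  have h₁ := TokenQC.step hq (e ▸ hs) hyz (e ▸ h)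
  have h₂ := h.step hq hs hxy
  have hs₂ := hs.sublist (sublist_delete_two p (z :: s) x y)
  have hb₂ := hb.of_append hxy
  have hb₁ := Balanced.of_append (e ▸ hb) hyz
  obtain ⟨x₁, b⟩ := x
  obtain ⟨y₁, b'⟩ := y
  obtain ⟨z₁, b''⟩ := z
  obtain rfl : b' = !b := by revert hxy; cases b <;> cases b' <;> simp
  obtain rfl : b'' = b := by revert hyz; cases b <;> cases b'' <;> simp
  have hneg : sgn (!b'') = -sgn b'' := by cases b'' <;> simp [sgn]
  have hne := sgn_ne_zero b''
  simp only [RowsFirst, List.pairwise_append, List.pairwise_cons, List.mem_cons] at hs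
  obtain ⟨-, ⟨hx, hy, hz, -⟩, hp⟩ := hs
  simp only [List.append_assoc, List.singleton_append] at h₁ hb₁
  have hxz : x₁ = false → z₁ = false := hx (z₁, b'') (.inr (.inl rfl))
  have hxy' : x₁ = false → y₁ = false := hx (y₁, !b'') (.inl rfl)
  have hyz' : y₁ = false → z₁ = false := hy (z₁, b'') (.inl rfl)
  by_cases hxz' : x₁ = z₁
  · subst hxz'
    have : y₁ = x₁ := by revert hxy' hyz'; cases x₁ <;> cases y₁ <;> simp
    subst this
    have := h₁.unique hq hroot hb₂ hs₂ h₂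
    simp only [defect, if_true, hneg] at this
    omega
  · obtain ⟨rfl, rfl⟩ : x₁ = true ∧ z₁ = false := by
      revert hxz hxz'; cases x₁ <;> cases z₁ <;> simp
    have := TokenQC.sub_eq hq hroot (fun a ha => by
        by_contra hne
        exact absurd (hp a ha _ (.inl rfl) (by simpa using hne)) (by simp))
      (fun a ha => hz a ha rfl) hb₁ h₁ h₂
    cases y₁ <;> simp [defect, hneg] at this <;> omega

end Tokens

section SymmetricDifference

/-- The indices `< N` that belong to exactly one of the two sets. -/
def diffList (N : ℕ) (I I' : Finset ℕ) : List ℕ :=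
  (List.range N).filter fun i => decide (i ∈ I) != decide (i ∈ I')

/-- The ground set of two pairs of index sets, listed in the order `cLT`. -/
def eltList (M N : ℕ) (I I' J J' : Finset ℕ) : List Elt :=
  (diffList M I I').map Sum.inl ++ (diffList N J J').reverse.map Sum.inr

/-- The sign of an element of the ground set: the white rows and the black columns are positive. -/
def eltSign (I J' : Finset ℕ) : Elt → Bool
  | .inl i => decide (i ∈ I)
  | .inr j => decide (j ∈ J')

theorem filter_mixed_wordOf (N : ℕ) (I I' : Finset ℕ) :
    (wordOf N I I').filter Mixed =
      (diffList N I I').map fun i => (decide (i ∈ I), decide (i ∈ I')) := by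
  rw [wordOf, List.filter_map]
  rfl

/-- The token of an element of the ground set. -/
def eltToken (I J' : Finset ℕ) (e : Elt) : Token := (e.isLeft, eltSign I J' e)

variable {M N : ℕ} {I I' J J' : Finset ℕ}

theorem rowWord_eltList : rowWord ((eltList M N I I' J J').map (eltToken I J')) =
    (wordOf M I I').filter Mixed := by
  rw [filter_mixed_wordOf, eltList, List.map_append, rowWord_append,
    rowWord_eq_nil (t := List.map _ (List.map Sum.inr _)), List.append_nil]
  · rw [rowWord, List.filter_eq_self.2, List.map_map, List.map_map]
    · refine List.map_congr_left fun i hi => ?_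
      have := (List.mem_filter.1 hi).2
      by_cases h : i ∈ I <;> simp_all [eltToken, eltSign]
    · simp [eltToken]
  · simp [eltToken]

theorem colWord_eltList : colWord ((eltList M N I I' J J').map (eltToken I J')) =
    (wordOf N J J').filter Mixed := by
  rw [filter_mixed_wordOf, eltList, List.map_append, colWord_append,
    colWord_eq_nil (t := List.map _ (List.map Sum.inl _)), List.append_nil]
  · rw [colWord, List.filter_eq_self.2, List.map_map, List.map_map, ← List.map_reverse,
      List.reverse_reverse]
    · refine List.map_congr_left fun i hi => ?_
      have := (List.mem_filter.1 hi).2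
      by_cases h : i ∈ J <;> simp_all [eltToken, eltSign]
    · simp [eltToken]
  · simp [eltToken]

theorem rowsFirst_eltList : RowsFirst ((eltList M N I I' J J').map (eltToken I J')) := by
  rw [eltList, List.map_append]
  refine List.pairwise_append.2 ⟨List.pairwise_of_forall_mem_list ?_,
    List.pairwise_of_forall_mem_list ?_, ?_⟩ <;> simp [eltToken]

theorem countP_decide_diffList (hI : I ∪ I' ⊆ Finset.range N) :
    (diffList N I I').countP (fun i => decide (i ∈ I)) = (I \ I').card := by
  rw [← count_fst_wordOf hI, wordOf, diffList, List.countP_filter, List.count, List.countP_map]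
  congr 1
  ext i
  by_cases h : i ∈ I <;> by_cases h' : i ∈ I' <;> simp [h, h']

theorem countP_not_decide_diffList (hI : I ∪ I' ⊆ Finset.range N) :
    (diffList N I I').countP (fun i => !decide (i ∈ I)) = (I' \ I).card := by
  rw [← count_snd_wordOf hI, wordOf, diffList, List.countP_filter, List.count, List.countP_map]
  congr 1
  ext i
  by_cases h : i ∈ I <;> by_cases h' : i ∈ I' <;> simp [h, h']

theorem diffList_comm : diffList N I I' = diffList N I' I := by
  unfold diffList
  congr 1
  ext i
  by_cases h : i ∈ I <;> by_cases h' : i ∈ I' <;> simp [h, h']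

theorem balanced_eltList (hI : I ∪ I' ⊆ Finset.range M) (hJ : J ∪ J' ⊆ Finset.range N)
    (h : I.card = J.card) (h' : I'.card = J'.card) :
    Balanced (eltSign I J') (eltList M N I I' J J') := by
  have e₁ := countP_decide_diffList hI
  have e₂ := countP_not_decide_diffList hI
  rw [Finset.union_comm] at hJ
  have e₃ := countP_decide_diffList hJ
  have e₄ := countP_not_decide_diffList hJ
  rw [diffList_comm] at e₃ e₄
  have a₁ := Finset.card_sdiff_add_card_inter I I'
  have a₂ := Finset.card_sdiff_add_card_inter I' I
  have a₃ := Finset.card_sdiff_add_card_inter J J'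
  have a₄ := Finset.card_sdiff_add_card_inter J' J
  rw [Finset.inter_comm] at a₂ a₄
  simp only [Balanced, eltList, List.countP_append, List.countP_map, List.countP_reverse]
  simp only [Function.comp_def, eltSign]
  omega

theorem Alt4.map {α β : Type} {ε : α → Bool} {ε' : β → Bool} (f : α → β)
    (hf : ∀ a, ε' (f a) = ε a) {t : List α} (h : Alt4 ε t) : Alt4 ε' (t.map f) := by
  obtain ⟨a, b, c, d, hs, h⟩ := h
  exact ⟨f a, f b, f c, f d, hs.map f, by simpa only [hf] using h⟩

/-- Quasicommuting minors exclude four elements of alternating signs. -/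
theorem QC.not_alt4 {K : Type} [Field K] {q : K} (hq : q ≠ 0)
    (hroot : ∀ c : ℤ, q ^ c = 1 → c = 0) (hI : I ∪ I' ⊆ Finset.range M)
    (hJ : J ∪ J' ⊆ Finset.range N) (h : I.card = J.card) (h' : I'.card = J'.card) {c : ℤ}
    (hc : QC q I J I' J' c) : ¬ Alt4 (eltSign I J') (eltList M N I I' J J') := by
  intro h4
  have hb := balanced_eltList hI hJ h h'
  refine TokenQC.not_alt4 hq hroot (t := (eltList M N I I' J J').map (eltToken I J')) (c := c) ?_
    rowsFirst_eltList ?_ (h4.map (eltToken I J') fun _ => rfl)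
  · rw [Balanced, List.countP_map, List.countP_map]
    exact hb
  · refine ⟨(wordOf M I I').count (true, true), (wordOf N J J').count (true, true), ?_, ?_⟩
    · rw [rowWord_eltList, colWord_eltList, List.count_filter (by rfl), List.count_filter (by rfl),
        count_both_wordOf hI, count_both_wordOf hJ, count_fst_wordOf hI, count_fst_wordOf hJ,
        add_comm, Finset.card_sdiff_add_card_inter, add_comm, Finset.card_sdiff_add_card_inter, h]
    · rw [rowWord_eltList, colWord_eltList, ← wordQC_normalize hq,
        wordQC_wordOf (Finset.union_subset_left hI) (Finset.union_subset_right hI)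
          (Finset.union_subset_left hJ) (Finset.union_subset_right hJ)]
      exact hc

end SymmetricDifference

section Matchings

theorem cLT_irrefl (a : Elt) : ¬ cLT a a := by
  rcases a with a | a <;> simp [cLT]

theorem cLT_trans {a b c : Elt} (h : cLT a b) (h' : cLT b c) : cLT a c := by
  rcases a with a | a <;> rcases b with b | b <;> rcases c with c | c <;> simp [cLT] at * <;> omega

theorem cLT_asymm {a b : Elt} (h : cLT a b) : ¬ cLT b a := fun h' => cLT_irrefl a (cLT_trans h h')

theorem cLT_or_cLT {a b : Elt} (h : a ≠ b) : cLT a b ∨ cLT b a := by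
  rcases a with a | a <;> rcases b with b | b <;> simp [cLT] at * <;> omega

instance : Std.Antisymm cLT := ⟨fun _ _ h h' => absurd h' (cLT_asymm h)⟩

variable {ε : Elt → Bool} {t p s : List Elt} {x y : Elt} {M M' : Finset (Elt × Elt)}

theorem nodup_of_pairwise (h : t.Pairwise cLT) : t.Nodup :=
  List.Pairwise.imp (fun {a b} (hab : cLT a b) (e : a = b) => cLT_irrefl b (e ▸ hab)) h

theorem alt4_iff (h : t.Pairwise cLT) : Alt4 ε t ↔ ∃ a ∈ t, ∃ b ∈ t, ∃ c ∈ t, ∃ d ∈ t,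
    cLT a b ∧ cLT b c ∧ cLT c d ∧ ε a ≠ ε b ∧ ε b ≠ ε c ∧ ε c ≠ ε d := by
  constructor
  · rintro ⟨a, b, c, d, hs, h'⟩
    have := h.sublist hs
    simp only [List.pairwise_cons, List.mem_cons, List.not_mem_nil, or_false] at this
    exact ⟨a, hs.subset (by simp), b, hs.subset (by simp), c, hs.subset (by simp), d,
      hs.subset (by simp), this.1 b (by simp), this.2.1 c (by simp), this.2.2.1 d rfl, h'⟩
  · rintro ⟨a, ha, b, hb, c, hc, d, hd, hab, hbc, hcd, h'⟩
    refine ⟨a, b, c, d, ?_, h'⟩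
    have hp : [a, b, c, d].Pairwise cLT := by
      have hac := cLT_trans hab hbc
      have hbd := cLT_trans hbc hcd
      have had := cLT_trans hac hcd
      simp [hab, hac, had, hbc, hbd, hcd]
    refine List.sublist_of_subperm_of_pairwise
      (List.subperm_of_subset (nodup_of_pairwise hp) ?_) hp h
    simp [ha, hb, hc, hd]

/-- A noncrossing perfect matching of the elements of `t` into couples of opposite signs. -/
structure IsMatching (ε : Elt → Bool) (t : List Elt) (M : Finset (Elt × Elt)) : Prop where
  mem : ∀ e ∈ M, e.1 ∈ t ∧ e.2 ∈ t ∧ cLT e.1 e.2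
  existsUnique : ∀ z ∈ t, ∃! e, e ∈ M ∧ (e.1 = z ∨ e.2 = z)
  ne : ∀ e ∈ M, ε e.1 ≠ ε e.2
  noncrossing : ∀ e ∈ M, ∀ e' ∈ M, ¬ (cLT e.1 e'.1 ∧ cLT e'.1 e.2 ∧ cLT e.2 e'.2)

theorem IsMatching.eq_of_mem (hM : IsMatching ε t M) {z : Elt} {e e' : Elt × Elt} (he : e ∈ M)
    (he' : e' ∈ M) (h : e.1 = z ∨ e.2 = z) (h' : e'.1 = z ∨ e'.2 = z) : e = e' := by
  have hz : z ∈ t := by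
    rcases h with rfl | rfl
    exacts [(hM.mem e he).1, (hM.mem e he).2.1]
  exact (hM.existsUnique z hz).unique ⟨he, h⟩ ⟨he', h'⟩

theorem cLT_of_pairwise (h : (p ++ x :: y :: s).Pairwise cLT) :
    cLT x y ∧ (∀ w ∈ p, cLT w x ∧ cLT w y) ∧ ∀ w ∈ s, cLT x w ∧ cLT y w := by
  simp only [List.pairwise_append, List.pairwise_cons, List.mem_cons] at h
  exact ⟨h.2.1.1 y (.inl rfl),
    fun w hw => ⟨h.2.2 w hw x (.inl rfl), h.2.2 w hw y (.inr (.inl rfl))⟩,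
    fun w hw => ⟨h.2.1.1 w (.inr hw), h.2.1.2.1 w hw⟩⟩

theorem not_between (h : (p ++ x :: y :: s).Pairwise cLT) {w : Elt} (hw : w ∈ p ++ s) :
    ¬ (cLT x w ∧ cLT w y) := by
  obtain ⟨-, hp, hs⟩ := cLT_of_pairwise h
  rintro ⟨h₁, h₂⟩
  rcases List.mem_append.1 hw with hw | hw
  · exact cLT_asymm h₁ (hp w hw).1
  · exact cLT_asymm h₂ (hs w hw).2

theorem mem_middle {w : Elt} : w ∈ p ++ x :: y :: s ↔ w = x ∨ w = y ∨ w ∈ p ++ s := by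
  simp only [List.mem_append, List.mem_cons]
  tauto

theorem ne_of_mem_append (h : (p ++ x :: y :: s).Pairwise cLT) {w : Elt} (hw : w ∈ p ++ s) :
    w ≠ x ∧ w ≠ y := by
  obtain ⟨-, hp, hs⟩ := cLT_of_pairwise h
  constructor <;> rintro rfl <;> rcases List.mem_append.1 hw with hw | hw
  exacts [cLT_irrefl _ (hp _ hw).1, cLT_irrefl _ (hs _ hw).1, cLT_irrefl _ (hp _ hw).2,
    cLT_irrefl _ (hs _ hw).2]

theorem IsMatching.insert (h : (p ++ x :: y :: s).Pairwise cLT) (hxy : ε x ≠ ε y)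
    (hM : IsMatching ε (p ++ s) M) : IsMatching ε (p ++ x :: y :: s) (insert (x, y) M) where
  mem e he := by
    rcases Finset.mem_insert.1 he with rfl | he
    · exact ⟨by simp, by simp, (cLT_of_pairwise h).1⟩
    · obtain ⟨h₁, h₂, h₃⟩ := hM.mem e he
      exact ⟨mem_middle.2 (.inr (.inr h₁)), mem_middle.2 (.inr (.inr h₂)), h₃⟩
  existsUnique z hz := by
    have hnot : ∀ e ∈ M, ∀ z, (e.1 = z ∨ e.2 = z) → z ≠ x ∧ z ≠ y := by
      rintro e he z (rfl | rfl)
      exacts [ne_of_mem_append h (hM.mem e he).1, ne_of_mem_append h (hM.mem e he).2.1]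
    by_cases hz' : z = x ∨ z = y
    · refine ⟨(x, y), ⟨Finset.mem_insert_self _ _, ?_⟩, ?_⟩
      · rcases hz' with rfl | rfl <;> simp
      · rintro e ⟨he, hez⟩
        rcases Finset.mem_insert.1 he with rfl | he
        · rfl
        · have := hnot e he z hez
          tauto
    · have hz₂ : z ∈ p ++ s := by
        rcases mem_middle.1 hz with h | h | h
        exacts [absurd (.inl h) hz', absurd (.inr h) hz', h]
      obtain ⟨e, ⟨he, hez⟩, hu⟩ := hM.existsUnique z hz₂
      refine ⟨e, ⟨Finset.mem_insert_of_mem he, hez⟩, ?_⟩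
      rintro e' ⟨he', hez'⟩
      rcases Finset.mem_insert.1 he' with rfl | he'
      · exact absurd (hez'.imp Eq.symm Eq.symm) hz'
      · exact hu e' ⟨he', hez'⟩
  ne e he := by
    rcases Finset.mem_insert.1 he with rfl | he
    exacts [hxy, hM.ne e he]
  noncrossing e he e' he' := by
    rintro ⟨h₁, h₂, h₃⟩
    rcases Finset.mem_insert.1 he with rfl | he <;> rcases Finset.mem_insert.1 he' with rfl | he'
    · exact cLT_irrefl _ h₁
    · exact not_between h (hM.mem e' he').1 ⟨h₁, h₂⟩
    · exact not_between h (hM.mem e he).2.1 ⟨h₂, h₃⟩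
    · exact hM.noncrossing e he e' he' ⟨h₁, h₂, h₃⟩

theorem IsMatching.erase (h : (p ++ x :: y :: s).Pairwise cLT)
    (hM : IsMatching ε (p ++ x :: y :: s) M) (hxy : (x, y) ∈ M) :
    IsMatching ε (p ++ s) (M.erase (x, y)) where
  mem e he := by
    obtain ⟨hne, he⟩ := Finset.mem_erase.1 he
    obtain ⟨h₁, h₂, h₃⟩ := hM.mem e he
    refine ⟨?_, ?_, h₃⟩
    · rcases mem_middle.1 h₁ with h | h | h
      exacts [absurd (hM.eq_of_mem he hxy (.inl h) (.inl rfl)) hne,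
        absurd (hM.eq_of_mem he hxy (.inl h) (.inr rfl)) hne, h]
    · rcases mem_middle.1 h₂ with h | h | h
      exacts [absurd (hM.eq_of_mem he hxy (.inr h) (.inl rfl)) hne,
        absurd (hM.eq_of_mem he hxy (.inr h) (.inr rfl)) hne, h]
  existsUnique z hz := by
    obtain ⟨e, ⟨he, hez⟩, hu⟩ := hM.existsUnique z (mem_middle.2 (.inr (.inr hz)))
    refine ⟨e, ⟨Finset.mem_erase.2 ⟨?_, he⟩, hez⟩,
      fun e' he' => hu e' ⟨Finset.mem_of_mem_erase he'.1, he'.2⟩⟩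
    rintro rfl
    have := ne_of_mem_append h hz
    rcases hez with rfl | rfl
    exacts [this.1 rfl, this.2 rfl]
  ne e he := hM.ne e (Finset.mem_of_mem_erase he)
  noncrossing e he e' he' :=
    hM.noncrossing e (Finset.mem_of_mem_erase he) e' (Finset.mem_of_mem_erase he')

theorem isMatching_nil_iff : IsMatching ε [] M ↔ M = ∅ := by
  constructor
  · intro hM
    rw [Finset.eq_empty_iff_forall_notMem]
    intro e he
    simpa using (hM.mem e he).1
  · rintro rfl
    constructor <;> simp

theorem exists_isMatching (h : t.Pairwise cLT) (hb : Balanced ε t) : ∃ M, IsMatching ε t M := by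
  induction hn : t.length using Nat.strong_induction_on generalizing t with
  | _ n ih =>
    by_cases ht : t = []
    · subst ht
      exact ⟨∅, isMatching_nil_iff.2 rfl⟩
    · obtain ⟨p, x, y, s, hxy, rfl⟩ := hb.exists_adjacent ht
      obtain ⟨M, hM⟩ := ih (p ++ s).length (by simp [← hn]) (h.sublist (sublist_delete_two p s x y))
        (hb.of_append hxy) rfl
      exact ⟨_, hM.insert h hxy⟩

theorem exists_two_isMatching_of_reflTransGen {t' : List Elt} (h : t.Pairwise cLT)
    (hr : Relation.ReflTransGen (Step ε) t t')
    (ht' : ∃ M M', IsMatching ε t' M ∧ IsMatching ε t' M' ∧ M ≠ M') :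
    ∃ M M', IsMatching ε t M ∧ IsMatching ε t M' ∧ M ≠ M' := by
  induction hr using Relation.ReflTransGen.head_induction_on with
  | refl => exact ht'
  | head hst _ ih =>
    obtain ⟨M, M', hM, hM', hne⟩ := ih (h.sublist hst.sublist)
    obtain ⟨p, x, y, s, hxy, rfl, rfl⟩ := hst
    refine ⟨_, _, hM.insert h hxy, hM'.insert h hxy, fun e => hne ?_⟩
    have hnot : ∀ M, IsMatching ε (p ++ s) M → (x, y) ∉ M := fun M hM hxy =>
      (ne_of_mem_append h (hM.mem _ hxy).1).1 rfl
    rw [← Finset.erase_insert (hnot M hM), e, Finset.erase_insert (hnot M' hM')]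

theorem exists_two_isMatching (h : t.Pairwise cLT) (hb : Balanced ε t) (h4 : Alt4 ε t) :
    ∃ M M', IsMatching ε t M ∧ IsMatching ε t M' ∧ M ≠ M' := by
  obtain ⟨p, x, y, z, s, hr, hxy, hyz⟩ := h4.exists_consecutive
  refine exists_two_isMatching_of_reflTransGen h hr ?_
  obtain ⟨hp, hb⟩ : (p ++ x :: y :: z :: s).Pairwise cLT ∧ Balanced ε (p ++ x :: y :: z :: s) := by
    generalize p ++ x :: y :: z :: s = t' at hr
    induction hr with
    | refl => exact ⟨h, hb⟩
    | tail _ hst ih => exact ⟨ih.1.sublist hst.sublist, ih.2.step hst⟩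
  have e : p ++ x :: y :: z :: s = (p ++ [x]) ++ y :: z :: s := by simp
  have hp' := e ▸ hp
  obtain ⟨M, hM⟩ := exists_isMatching (hp.sublist (sublist_delete_two p (z :: s) x y))
    (hb.of_append hxy)
  obtain ⟨M', hM'⟩ := exists_isMatching (hp'.sublist (sublist_delete_two _ s y z))
    (Balanced.of_append (e ▸ hb) hyz)
  have h₁ := hM.insert hp hxy
  have h₂ := hM'.insert hp' hyz
  rw [← e] at h₂
  refine ⟨_, _, h₁, h₂, fun heq => ?_⟩
  have := h₁.eq_of_mem (z := y) (e := (x, y)) (e' := (y, z)) (Finset.mem_insert_self _ _)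
    (heq ▸ Finset.mem_insert_self _ _) (.inr rfl) (.inl rfl)
  rw [Prod.mk.injEq] at this
  exact hxy (congrArg ε this.1)

theorem IsMatching.exists_couple (hM : IsMatching ε t M) {z : Elt} (hz : z ∈ t) :
    ∃ w ∈ t, ε w ≠ ε z ∧ ((cLT w z ∧ (w, z) ∈ M) ∨ (cLT z w ∧ (z, w) ∈ M)) := by
  obtain ⟨⟨a, b⟩, ⟨he, rfl | rfl⟩, -⟩ := hM.existsUnique z hz
  · exact ⟨b, (hM.mem _ he).2.1, (hM.ne _ he).symm, .inr ⟨(hM.mem _ he).2.2, he⟩⟩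
  · exact ⟨a, (hM.mem _ he).1, hM.ne _ he, .inl ⟨(hM.mem _ he).2.2, he⟩⟩

theorem IsMatching.adjacent_mem (h : (p ++ x :: y :: s).Pairwise cLT) (hxy : ε x ≠ ε y)
    (h4 : ¬ Alt4 ε (p ++ x :: y :: s)) (hM : IsMatching ε (p ++ x :: y :: s) M) : (x, y) ∈ M := by
  by_contra hnot
  rw [alt4_iff h] at h4
  have hlt := (cLT_of_pairwise h).1
  have hx : x ∈ p ++ x :: y :: s := by simp
  have hy : y ∈ p ++ x :: y :: s := by simp
  obtain ⟨u, hu, hux, hu'⟩ := hM.exists_couple hx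
  obtain ⟨v, hv, hvy, hv'⟩ := hM.exists_couple hy
  have huy : u ≠ y := by
    rintro rfl
    rcases hu' with hu' | hu'
    exacts [cLT_asymm hlt hu'.1, hnot hu'.2]
  have hvx : v ≠ x := by
    rintro rfl
    rcases hv' with hv' | hv'
    exacts [hnot hv'.2, cLT_asymm hlt hv'.1]
  have e₁ : ε u = ε y := by revert hux hxy; cases ε u <;> cases ε x <;> cases ε y <;> simp
  have e₂ : ε v = ε x := by revert hvy hxy; cases ε v <;> cases ε x <;> cases ε y <;> simp
  have huv : u ≠ v := fun e => hxy (e₂.symm.trans ((congrArg ε e.symm).trans e₁))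
  rcases hu' with ⟨hu', hu''⟩ | ⟨hu', hu''⟩ <;> rcases hv' with ⟨hv', hv''⟩ | ⟨hv', hv''⟩
  · have hvx' : cLT v x := (cLT_or_cLT hvx).resolve_right fun h' =>
      not_between h (w := v) ((mem_middle.1 hv).resolve_left hvx |>.resolve_left
        fun e => cLT_irrefl v (by rwa [← e] at hv')) ⟨h', hv'⟩
    rcases cLT_or_cLT huv with huv' | huv'
    · exact hM.noncrossing _ hu'' _ hv'' ⟨huv', hvx', hlt⟩
    · exact h4 ⟨v, hv, u, hu, x, hx, y, hy, huv', hu', hlt, by rw [e₁, e₂]; exact hxy, hux, hxy⟩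
  · exact h4 ⟨u, hu, x, hx, y, hy, v, hv, hu', hlt, hv', hux, hxy, hvy.symm⟩
  · have hvx' : cLT v x := (cLT_or_cLT hvx).resolve_right fun h' =>
      not_between h (w := v) ((mem_middle.1 hv).resolve_left hvx |>.resolve_left
        fun e => cLT_irrefl v (by rwa [← e] at hv')) ⟨h', hv'⟩
    have huy' : cLT y u := (cLT_or_cLT huy).resolve_left fun h' =>
      not_between h (w := u) ((mem_middle.1 hu).resolve_left
        (fun e => hux (congrArg ε e)) |>.resolve_left huy) ⟨hu', h'⟩
    exact hM.noncrossing _ hv'' _ hu'' ⟨hvx', hlt, huy'⟩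
  · have huy' : cLT y u := (cLT_or_cLT huy).resolve_left fun h' =>
      not_between h (w := u) ((mem_middle.1 hu).resolve_left
        (fun e => hux (congrArg ε e)) |>.resolve_left huy) ⟨hu', h'⟩
    rcases cLT_or_cLT huv with huv' | huv'
    · exact hM.noncrossing _ hu'' _ hv'' ⟨hlt, huy', huv'⟩
    · exact h4 ⟨x, hx, y, hy, v, hv, u, hu, hlt, hv', huv', hxy, hvy.symm, by
        rw [e₁, e₂]; exact hxy⟩

theorem IsMatching.unique (h : t.Pairwise cLT) (hb : Balanced ε t) (h4 : ¬ Alt4 ε t)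
    (hM : IsMatching ε t M) (hM' : IsMatching ε t M') : M = M' := by
  induction hn : t.length using Nat.strong_induction_on generalizing t M M' with
  | _ n ih =>
    by_cases ht : t = []
    · subst ht
      rw [isMatching_nil_iff.1 hM, isMatching_nil_iff.1 hM']
    · obtain ⟨p, x, y, s, hxy, rfl⟩ := hb.exists_adjacent ht
      have hm := hM.adjacent_mem h hxy h4
      have hm' := hM'.adjacent_mem h hxy h4
      have hsub := sublist_delete_two p s x y
      have := ih (p ++ s).length (by simp [← hn]) (h.sublist hsub) (hb.of_append hxy)
        (fun ⟨a, b, c, d, hs, h⟩ => h4 ⟨a, b, c, d, hs.trans hsub, h⟩)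
        (hM.erase h hm) (hM'.erase h hm') rfl
      rw [← Finset.insert_erase hm, this, Finset.insert_erase hm']

theorem existsUnique_isMatching_iff (h : t.Pairwise cLT) (hb : Balanced ε t) :
    (∃! M, IsMatching ε t M) ↔ ¬ Alt4 ε t := by
  constructor
  · intro hu h4
    obtain ⟨M, M', hM, hM', hne⟩ := exists_two_isMatching h hb h4
    exact hne (hu.unique hM hM')
  · intro h4
    obtain ⟨M, hM⟩ := exists_isMatching h hb
    exact ⟨M, hM, fun M' hM' => hM'.unique h hb h4 hM⟩

end Matchings

section Feasible

theorem mem_diffList {N : ℕ} {I I' : Finset ℕ} (hN : I ∪ I' ⊆ Finset.range N) {i : ℕ} :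
    i ∈ diffList N I I' ↔ i ∈ I \ I' ∨ i ∈ I' \ I := by
  have : i ∈ I ∨ i ∈ I' → i < N := fun h => Finset.mem_range.1 (hN (Finset.mem_union.2 h))
  by_cases h : i ∈ I <;> by_cases h' : i ∈ I' <;> simp_all [diffList]

theorem pairwise_eltList {M N : ℕ} {I I' J J' : Finset ℕ} :
    (eltList M N I I' J J').Pairwise cLT := by
  have hd : ∀ (N : ℕ) (I I' : Finset ℕ), (diffList N I I').Pairwise (· < ·) := fun N I I' =>
    List.pairwise_lt_range.sublist List.filter_sublist
  refine List.pairwise_append.2 ⟨List.pairwise_map.2 (hd M I I'),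
    List.pairwise_map.2 (List.pairwise_reverse.2 (hd N J J')), ?_⟩
  intro a ha b hb
  obtain ⟨i, -, rfl⟩ := List.mem_map.1 ha
  obtain ⟨j, -, rfl⟩ := List.mem_map.1 hb
  trivial

variable {m n : ℕ} (S : Cortege m n)

/-- The ground set of a cortege, listed in the order `cLT`. -/
def groundList : List Elt := eltList (m + 1) (n + 1) S.I S.I' S.J S.J'

/-- The sign of an element of the ground set of a cortege. -/
def groundSign : Elt → Bool := eltSign S.I S.J'

theorem subset_range_of_subset_Icc {I I' : Finset ℕ} {N : ℕ} (h : I ⊆ Finset.Icc 1 N)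
    (h' : I' ⊆ Finset.Icc 1 N) : I ∪ I' ⊆ Finset.range (N + 1) := by
  intro i hi
  have := Finset.mem_Icc.1 (Finset.union_subset h h' hi)
  exact Finset.mem_range.2 (by omega)

theorem mem_groundList {e : Elt} : e ∈ groundList S ↔ e ∈ S.ground := by
  rcases e with i | j
  · simp [groundList, eltList, Cortege.ground, Cortege.whites, Cortege.blacks,
      mem_diffList (subset_range_of_subset_Icc S.hIm S.hI'm)]
  · simp [groundList, eltList, Cortege.ground, Cortege.whites, Cortege.blacks,
      mem_diffList (subset_range_of_subset_Icc S.hJn S.hJ'n)]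

theorem mem_whites_iff {e : Elt} (he : e ∈ S.ground) :
    e ∈ S.whites ↔ groundSign S e = e.isLeft := by
  rcases e with i | j <;>
    simp [Cortege.ground, Cortege.whites, Cortege.blacks, groundSign, eltSign] at he ⊢ <;> tauto

theorem mem_blacks_iff {e : Elt} (he : e ∈ S.ground) :
    e ∈ S.blacks ↔ groundSign S e ≠ e.isLeft := by
  rcases e with i | j <;>
    simp [Cortege.ground, Cortege.whites, Cortege.blacks, groundSign, eltSign] at he ⊢ <;> tauto

theorem isFeasible_iff {M : Finset (Elt × Elt)} :
    IsFeasible S M ↔ IsMatching (groundSign S) (groundList S) M := by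
  have hcol : ∀ p : Elt × Elt, p.1 ∈ S.ground → p.2 ∈ S.ground →
      (((sameSide p.1 p.2 → (p.1 ∈ S.whites ↔ p.2 ∈ S.blacks)) ∧
        (¬ sameSide p.1 p.2 → (p.1 ∈ S.whites ↔ p.2 ∈ S.whites))) ↔
        groundSign S p.1 ≠ groundSign S p.2) := by
    intro p h₁ h₂
    rw [mem_whites_iff S h₁, mem_whites_iff S h₂, mem_blacks_iff S h₂, sameSide]
    cases p.1.isLeft <;> cases p.2.isLeft <;> cases groundSign S p.1 <;>
      cases groundSign S p.2 <;> simp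
  constructor
  · rintro ⟨h₁, h₂, h₃, h₄⟩
    refine ⟨fun e he => ?_, fun z hz => h₂ z ((mem_groundList S).1 hz), fun e he => ?_, h₄⟩
    · simpa only [mem_groundList] using h₁ e he
    · exact (hcol e (h₁ e he).1 (h₁ e he).2.1).1 (h₃ e he)
  · rintro ⟨h₁, h₂, h₃, h₄⟩
    simp only [mem_groundList] at h₁ h₂
    exact ⟨h₁, h₂, fun e he => (hcol e (h₁ e he).1 (h₁ e he).2.1).2 (h₃ e he), h₄⟩

theorem existsUnique_isFeasible_iff :
    (∃! M, IsFeasible S M) ↔ ¬ Alt4 (groundSign S) (groundList S) := by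
  simp only [isFeasible_iff]
  exact existsUnique_isMatching_iff pairwise_eltList
    (balanced_eltList (subset_range_of_subset_Icc S.hIm S.hI'm)
      (subset_range_of_subset_Icc S.hJn S.hJ'n) S.hIJ S.hI'J')

end Feasible

section WeakSeparation

/-- No element of `B` lies between two elements of `A`. -/
def NoneBetween (A B : Finset ℕ) : Prop := ∀ a ∈ A, ∀ b ∈ B, ∀ a' ∈ A, a < b → ¬ b < a'

theorem wShalf_iff {I J : Finset ℕ} :
    WShalf I J ↔ J.card ≤ I.card ∧ NoneBetween (I \ J) (J \ I) := by
  refine and_congr_right fun _ => ⟨?_, fun h => ?_⟩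
  · rintro ⟨J₁, J₂, -, hu, h₁, h₂⟩ a ha b hb a' ha' hab hba'
    rw [← hu, Finset.mem_union] at hb
    rcases hb with hb | hb
    · exact (h₁ b hb a ha).not_gt hab
    · exact (h₂ a' ha' b hb).not_gt hba'
  · refine ⟨(J \ I).filter fun b => ∀ w ∈ I \ J, b < w,
      (J \ I).filter fun b => ¬ ∀ w ∈ I \ J, b < w,
      Finset.disjoint_filter_filter_not _ _ _, Finset.filter_union_filter_not_eq _ _, ?_, ?_⟩
    · intro b hb w hw
      exact (Finset.mem_filter.1 hb).2 w hw
    · intro w hw b hb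
      obtain ⟨hb, hb'⟩ := Finset.mem_filter.1 hb
      push Not at hb'
      obtain ⟨w', hw', hbw'⟩ := hb'
      have hne : ∀ w ∈ I \ J, w ≠ b := by
        rintro w hw rfl
        exact (Finset.mem_sdiff.1 hw).2 (Finset.mem_sdiff.1 hb).1
      have h₁ := hne w hw
      have h₂ := hne w' hw'
      have h₃ := h w' hw' b hb w hw (by omega)
      omega

/-- Positive rows `A`, negative rows `B`, negative columns `C` and positive columns `D`. -/
def HasSign (A B C D : Finset ℕ) : Bool → Elt → Prop
  | true, .inl i => i ∈ A
  | false, .inl i => i ∈ B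
  | true, .inr j => j ∈ D
  | false, .inr j => j ∈ C

/-- There are four elements of alternating signs. -/
def Alternating (A B C D : Finset ℕ) : Prop :=
  ∃ b x₁ x₂ x₃ x₄, HasSign A B C D b x₁ ∧ HasSign A B C D (!b) x₂ ∧ HasSign A B C D b x₃ ∧
    HasSign A B C D (!b) x₄ ∧ cLT x₁ x₂ ∧ cLT x₂ x₃ ∧ cLT x₃ x₄

variable {A B C D : Finset ℕ}

/-- If both sets have an element between two elements of the other one, then there are four
elements taken alternatingly from the two sets. -/
theorem exists_four_of_not_noneBetween (hAB : Disjoint A B) (h : ¬ NoneBetween A B)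
    (h' : ¬ NoneBetween B A) :
    (∃ a ∈ A, ∃ b ∈ B, ∃ a' ∈ A, ∃ b' ∈ B, a < b ∧ b < a' ∧ a' < b') ∨
      ∃ b ∈ B, ∃ a ∈ A, ∃ b' ∈ B, ∃ a' ∈ A, b < a ∧ a < b' ∧ b' < a' := by
  simp only [NoneBetween, not_forall, not_not] at h h'
  obtain ⟨a, ha, b, hb, a', ha', h₁, h₂⟩ := h
  obtain ⟨b₁, hb₁, a₁, ha₁, b₂, hb₂, h₃, h₄⟩ := h'
  have hne : a ≠ b₁ := fun e => Finset.disjoint_left.1 hAB ha (e ▸ hb₁)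
  rcases lt_or_gt_of_ne hne with hlt | hlt
  · exact .inl ⟨a, ha, b₁, hb₁, a₁, ha₁, b₂, hb₂, hlt, h₃, h₄⟩
  · exact .inr ⟨b₁, hb₁, a, ha, b, hb, a', ha', hlt, h₁, h₂⟩

theorem finsetLT_or_finsetLT (hAB : Disjoint A B) (h : NoneBetween A B) (h' : NoneBetween B A) :
    finsetLT A B ∨ finsetLT B A := by
  by_contra! hc
  simp only [finsetLT, not_forall, not_lt] at hc
  obtain ⟨⟨a, ha, b, hb, h₁⟩, b', hb', a', ha', h₂⟩ := hc
  have hne : ∀ a ∈ A, ∀ b ∈ B, a ≠ b := fun a ha b hb e =>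
    Finset.disjoint_left.1 hAB ha (e ▸ hb)
  have n₁ := hne a ha b hb
  have n₂ := hne a' ha' b' hb'
  have n₃ := hne a ha b' hb'
  have k₁ := h a' ha' b' hb' a ha (by omega)
  have k₂ := h' b hb a ha b' hb' (by omega)
  omega

theorem alternating_iff (hAB : Disjoint A B) (hCD : Disjoint C D)
    (hcard : A.card + D.card = B.card + C.card) (hBA : B.card ≤ A.card) :
    ¬ Alternating A B C D ↔
      (NoneBetween A B ∨ A.card = B.card ∧ NoneBetween B A) ∧
      (NoneBetween C D ∨ C.card = D.card ∧ NoneBetween D C) ∧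
      ((B = ∅ ∨ D = ∅) ∨ (B.Nonempty ∧ D.Nonempty ∧
        ((finsetLT A B ∧ finsetLT D C) ∨ (finsetLT B A ∧ finsetLT C D)))) := by
  constructor
  · intro h
    have h_ABA : C.Nonempty → NoneBetween A B := fun ⟨c, hc⟩ a ha b hb a' ha' h₁ h₂ =>
      h ⟨true, .inl a, .inl b, .inl a', .inr c, ha, hb, ha', hc, h₁, h₂, trivial⟩
    have h_BAB : D.Nonempty → NoneBetween B A := fun ⟨d, hd⟩ b hb a ha b' hb' h₁ h₂ =>
      h ⟨false, .inl b, .inl a, .inl b', .inr d, hb, ha, hb', hd, h₁, h₂, trivial⟩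
    have h_CDC : A.Nonempty → NoneBetween C D := fun ⟨a, ha⟩ c hc d hd c' hc' h₁ h₂ =>
      h ⟨true, .inl a, .inr c', .inr d, .inr c, ha, hc', hd, hc, trivial, h₂, h₁⟩
    have h_DCD : B.Nonempty → NoneBetween D C := fun ⟨b, hb⟩ d hd c hc d' hd' h₁ h₂ =>
      h ⟨false, .inl b, .inr d', .inr c, .inr d, hb, hd', hc, hd, trivial, h₂, h₁⟩
    refine ⟨?_, ?_, ?_⟩
    · by_contra! hc
      have hC : C = ∅ := by
        by_contra hC
        exact hc.1 (h_ABA (Finset.nonempty_iff_ne_empty.2 hC))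
      have hC' : C.card = 0 := by rw [hC, Finset.card_empty]
      rcases exists_four_of_not_noneBetween hAB hc.1 (hc.2 (by omega)) with
        ⟨a, ha, b, hb, a', ha', b', hb', h₁, h₂, h₃⟩ | ⟨b, hb, a, ha, b', hb', a', ha', h₁, h₂, h₃⟩
      · exact h ⟨true, .inl a, .inl b, .inl a', .inl b', ha, hb, ha', hb', h₁, h₂, h₃⟩
      · exact h ⟨false, .inl b, .inl a, .inl b', .inl a', hb, ha, hb', ha', h₁, h₂, h₃⟩
    · by_contra! hc
      have hA : A = ∅ := by
        by_contra hA
        exact hc.1 (h_CDC (Finset.nonempty_iff_ne_empty.2 hA))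
      have hA' : A.card = 0 := by rw [hA, Finset.card_empty]
      rcases exists_four_of_not_noneBetween hCD hc.1 (hc.2 (by omega)) with
        ⟨c, hc, d, hd, c', hc', d', hd', h₁, h₂, h₃⟩ | ⟨d, hd, c, hc, d', hd', c', hc', h₁, h₂, h₃⟩
      · exact h ⟨true, .inr d', .inr c', .inr d, .inr c, hd', hc', hd, hc, h₃, h₂, h₁⟩
      · exact h ⟨false, .inr c', .inr d', .inr c, .inr d, hc', hd', hc, hd, h₃, h₂, h₁⟩
    · by_contra! hc
      obtain ⟨⟨hB, hD⟩, hc⟩ := hc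
      have hA : A.Nonempty := Finset.card_pos.1 (hB.card_pos.trans_le hBA)
      have hC : C.Nonempty := Finset.card_pos.1 (hD.card_pos.trans_le (by omega))
      have hcross : finsetLT A B → ¬ finsetLT C D := by
        obtain ⟨a, ha⟩ := hA
        obtain ⟨b, hb⟩ := hB
        obtain ⟨c, hc⟩ := hC
        obtain ⟨d, hd⟩ := hD
        exact fun h₁ h₂ => h ⟨true, .inl a, .inl b, .inr d, .inr c, ha, hb, hd, hc,
          h₁ a ha b hb, trivial, h₂ c hc d hd⟩
      have hcross' : finsetLT B A → ¬ finsetLT D C := by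
        obtain ⟨a, ha⟩ := hA
        obtain ⟨b, hb⟩ := hB
        obtain ⟨c, hc⟩ := hC
        obtain ⟨d, hd⟩ := hD
        exact fun h₁ h₂ => h ⟨false, .inl b, .inl a, .inr c, .inr d, hb, ha, hc, hd,
          h₁ b hb a ha, trivial, h₂ d hd c hc⟩
      have hc := hc hB hD
      rcases finsetLT_or_finsetLT hAB (h_ABA hC) (h_BAB hD) with h₁ | h₁ <;>
        rcases finsetLT_or_finsetLT hCD (h_CDC hA) (h_DCD hB) with h₂ | h₂
      · exact hcross h₁ h₂
      · exact hc.1 h₁ h₂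
      · exact hc.2 h₁ h₂
      · exact hcross' h₁ h₂
  · rintro ⟨hrow, hcol, hsep⟩ ⟨b, x₁, x₂, x₃, x₄, h₁, h₂, h₃, h₄, l₁, l₂, l₃⟩
    have sep : ∀ b ∈ B, ∀ d ∈ D, (finsetLT A B ∧ finsetLT D C) ∨ (finsetLT B A ∧ finsetLT C D) := by
      intro b hb d hd
      rcases hsep with (rfl | rfl) | ⟨-, -, h⟩
      · simp at hb
      · simp at hd
      · exact h
    have h_BAB : ∀ d ∈ D, NoneBetween B A := by
      intro d hd b hb a ha b' hb' h₁ h₂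
      rcases sep b hb d hd with ⟨h, -⟩ | ⟨h, -⟩
      · exact (h a ha b hb).not_gt h₁
      · exact (h b' hb' a ha).not_gt h₂
    have h_DCD : ∀ b ∈ B, NoneBetween D C := by
      intro b hb d hd c hc d' hd' h₁ h₂
      rcases sep b hb d hd with ⟨-, h⟩ | ⟨-, h⟩
      · exact (h d' hd' c hc).not_gt h₂
      · exact (h c hc d hd).not_gt h₁
    have h_ABA : ∀ c ∈ C, NoneBetween A B := by
      intro c hc
      rcases hrow with h | ⟨hAB', -⟩
      · exact h
      intro a ha b hb a' ha' h₁ h₂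
      obtain ⟨d, hd⟩ : D.Nonempty := by
        have := Finset.card_pos.2 ⟨c, hc⟩
        exact Finset.card_pos.1 (by omega)
      rcases sep b hb d hd with ⟨h, -⟩ | ⟨h, -⟩
      · exact (h a' ha' b hb).not_gt h₂
      · exact (h b hb a ha).not_gt h₁
    have h_CDC : ∀ a ∈ A, NoneBetween C D := by
      intro a ha
      rcases hcol with h | ⟨hCD', -⟩
      · exact h
      intro c hc d hd c' hc' h₁ h₂
      obtain ⟨b, hb⟩ : B.Nonempty := by
        have := Finset.card_pos.2 ⟨a, ha⟩
        exact Finset.card_pos.1 (by omega)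
      rcases sep b hb d hd with ⟨-, h⟩ | ⟨-, h⟩
      · exact (h d hd c hc).not_gt h₁
      · exact (h c' hc' d hd).not_gt h₂
    have hcross : ∀ a ∈ A, ∀ b ∈ B, ∀ c ∈ C, ∀ d ∈ D, a < b → ¬ c < d := by
      intro a ha b hb c hc d hd h₁ h₂
      rcases sep b hb d hd with ⟨-, h⟩ | ⟨h, -⟩
      · exact (h d hd c hc).not_gt h₂
      · exact (h b hb a ha).not_gt h₁
    have hcross' : ∀ a ∈ A, ∀ b ∈ B, ∀ c ∈ C, ∀ d ∈ D, b < a → ¬ d < c := by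
      intro a ha b hb c hc d hd h₁ h₂
      rcases sep b hb d hd with ⟨h, -⟩ | ⟨-, h⟩
      · exact (h a ha b hb).not_gt h₁
      · exact (h c hc d hd).not_gt h₂
    cases b <;> rcases x₁ with x₁ | x₁ <;> rcases x₂ with x₂ | x₂ <;> rcases x₃ with x₃ | x₃ <;>
      rcases x₄ with x₄ | x₄ <;>
      simp only [HasSign, cLT, Bool.not_true, Bool.not_false] at h₁ h₂ h₃ h₄ l₁ l₂ l₃
    · rcases hrow with h | ⟨-, h⟩
      · exact h x₂ h₂ x₃ h₃ x₄ h₄ l₂ l₃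
      · exact h x₁ h₁ x₂ h₂ x₃ h₃ l₁ l₂
    · exact h_BAB x₄ h₄ x₁ h₁ x₂ h₂ x₃ h₃ l₁ l₂
    · exact hcross' x₂ h₂ x₁ h₁ x₃ h₃ x₄ h₄ l₁ l₃
    · exact h_DCD x₁ h₁ x₄ h₄ x₃ h₃ x₂ h₂ l₃ l₂
    · rcases hcol with h | ⟨-, h⟩
      · exact h x₃ h₃ x₂ h₂ x₁ h₁ l₂ l₁
      · exact h x₄ h₄ x₃ h₃ x₂ h₂ l₃ l₂
    · rcases hrow with h | ⟨-, h⟩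
      · exact h x₁ h₁ x₂ h₂ x₃ h₃ l₁ l₂
      · exact h x₂ h₂ x₃ h₃ x₄ h₄ l₂ l₃
    · exact h_ABA x₄ h₄ x₁ h₁ x₂ h₂ x₃ h₃ l₁ l₂
    · exact hcross x₁ h₁ x₂ h₂ x₄ h₄ x₃ h₃ l₁ l₃
    · exact h_CDC x₁ h₁ x₄ h₄ x₃ h₃ x₂ h₂ l₃ l₂
    · rcases hcol with h | ⟨-, h⟩
      · exact h x₄ h₄ x₃ h₃ x₂ h₂ l₃ l₂
      · exact h x₃ h₃ x₂ h₂ x₁ h₁ l₂ l₁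

end WeakSeparation

section Equivalences

variable {m n : ℕ} (S : Cortege m n)

theorem alt4_ground_iff : Alt4 (groundSign S) (groundList S) ↔
    Alternating (S.I \ S.I') (S.I' \ S.I) (S.J \ S.J') (S.J' \ S.J) := by
  have key : ∀ b e, HasSign (S.I \ S.I') (S.I' \ S.I) (S.J \ S.J') (S.J' \ S.J) b e ↔
      e ∈ groundList S ∧ groundSign S e = b := by
    intro b e
    rw [mem_groundList]
    rcases e with i | j <;> cases b <;>
      simp [HasSign, Cortege.ground, Cortege.whites, Cortege.blacks, groundSign, eltSign] <;> tauto
  rw [groundList, alt4_iff pairwise_eltList, Alternating]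
  simp only [key]
  constructor
  · rintro ⟨a, ha, b, hb, c, hc, d, hd, l₁, l₂, l₃, n₁, n₂, n₃⟩
    refine ⟨groundSign S a, a, b, c, d, ⟨ha, rfl⟩, ⟨hb, ?_⟩, ⟨hc, ?_⟩, ⟨hd, ?_⟩, l₁, l₂, l₃⟩ <;>
      revert n₁ n₂ n₃ <;> cases groundSign S a <;> cases groundSign S b <;>
      cases groundSign S c <;> cases groundSign S d <;> simp
  · rintro ⟨s, a, b, c, d, ⟨ha, ea⟩, ⟨hb, eb⟩, ⟨hc, ec⟩, ⟨hd, ed⟩, l₁, l₂, l₃⟩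
    refine ⟨a, ha, b, hb, c, hc, d, hd, l₁, l₂, l₃, ?_, ?_, ?_⟩ <;> simp [ea, eb, ec, ed]

theorem weaklySeparated_iff {I J : Finset ℕ} (h : J.card ≤ I.card) :
    WeaklySeparated I J ↔ NoneBetween (I \ J) (J \ I) ∨
      (I \ J).card = (J \ I).card ∧ NoneBetween (J \ I) (I \ J) := by
  have h₁ := Finset.card_sdiff_add_card_inter I J
  have h₂ := Finset.card_sdiff_add_card_inter J I
  rw [Finset.inter_comm] at h₂
  rw [WeaklySeparated, wShalf_iff, wShalf_iff, and_iff_right h]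
  exact or_congr_right (and_congr_left fun _ => by omega)

theorem existsUnique_isFeasible_iff_weaklySeparated (hcard : S.I'.card ≤ S.I.card) :
    (∃! M, IsFeasible S M) ↔
      (WeaklySeparated S.I S.I' ∧ WeaklySeparated S.J S.J' ∧
        ((S.I' \ S.I = ∅ ∨ S.J' \ S.J = ∅) ∨
          ((S.I' \ S.I).Nonempty ∧ (S.J' \ S.J).Nonempty ∧
            ((finsetLT (S.I \ S.I') (S.I' \ S.I) ∧ finsetLT (S.J' \ S.J) (S.J \ S.J')) ∨
             (finsetLT (S.I' \ S.I) (S.I \ S.I') ∧ finsetLT (S.J \ S.J') (S.J' \ S.J)))))) := by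
  have hJ : S.J'.card ≤ S.J.card := by rw [← S.hIJ, ← S.hI'J']; exact hcard
  have h₁ := Finset.card_sdiff_add_card_inter S.I S.I'
  have h₂ := Finset.card_sdiff_add_card_inter S.I' S.I
  have h₃ := Finset.card_sdiff_add_card_inter S.J S.J'
  have h₄ := Finset.card_sdiff_add_card_inter S.J' S.J
  have h₅ := S.hIJ
  have h₆ := S.hI'J'
  rw [Finset.inter_comm] at h₂ h₄
  rw [existsUnique_isFeasible_iff, alt4_ground_iff,
    alternating_iff disjoint_sdiff_sdiff disjoint_sdiff_sdiff (by omega) (by omega),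
    weaklySeparated_iff hcard, weaklySeparated_iff hJ]

theorem FullQ.isQMatrix {K A : Type} [Field K] [Ring A] [Algebra K A] {q : K} {x : ℕ → ℕ → A}
    (hx : FullQ q x) (m n : ℕ) : IsQMatrix q m n x := by
  refine ⟨fun i j k _ _ _ hjk _ => hx.1 i j k hjk, fun i l j _ hil _ _ _ => (hx.2 i l hil).col j,
    fun i l j k _ hil _ _ hjk _ => (hx.2 i l hil).anti j k hjk,
    fun i l j k _ hil _ _ hjk _ => ?_⟩
  rw [(hx.2 i l hil).diag j k hjk, add_sub_cancel_left]

/-- The matrix that agrees with `x` in its upper left `m × n` block and vanishes elsewhere. -/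
def truncate {A : Type} [Zero A] (m n : ℕ) (x : ℕ → ℕ → A) (i j : ℕ) : A :=
  if i ∈ Finset.Icc 1 m ∧ j ∈ Finset.Icc 1 n then x i j else 0

theorem fullQ_truncate {K A : Type} [Field K] [Ring A] [Algebra K A] {q : K} {x : ℕ → ℕ → A}
    {m n : ℕ} (hx : IsQMatrix q m n x) : FullQ q (truncate m n x) := by
  obtain ⟨hrow, hcol, hanti, hdiag⟩ := hx
  refine ⟨fun i j k hjk => ?_, fun i l hil => ⟨fun j => ?_, fun j k hjk => ?_, fun j k hjk => ?_⟩⟩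
  · by_cases hi : i ∈ Finset.Icc 1 m <;> by_cases hj : j ∈ Finset.Icc 1 n <;>
      by_cases hk : k ∈ Finset.Icc 1 n <;> simp only [truncate, hi, hj, hk] <;> simp
    simp only [Finset.mem_Icc] at hi hj hk
    exact hrow i j k hi.1 hi.2 hj.1 hjk hk.2
  · by_cases hi : i ∈ Finset.Icc 1 m <;> by_cases hl : l ∈ Finset.Icc 1 m <;>
      by_cases hj : j ∈ Finset.Icc 1 n <;> simp only [truncate, hi, hj, hl] <;> simp
    simp only [Finset.mem_Icc] at hi hl hj
    exact hcol i l j hi.1 hil hl.2 hj.1 hj.2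
  · by_cases hi : i ∈ Finset.Icc 1 m <;> by_cases hl : l ∈ Finset.Icc 1 m <;>
      by_cases hj : j ∈ Finset.Icc 1 n <;> by_cases hk : k ∈ Finset.Icc 1 n <;>
      simp only [truncate, hi, hj, hl, hk] <;> simp
    simp only [Finset.mem_Icc] at hi hl hj hk
    exact hanti i l j k hi.1 hil hl.2 hj.1 hjk hk.2
  · by_cases hi : i ∈ Finset.Icc 1 m <;> by_cases hl : l ∈ Finset.Icc 1 m <;>
      by_cases hj : j ∈ Finset.Icc 1 n <;> by_cases hk : k ∈ Finset.Icc 1 n <;>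
      simp only [truncate, hi, hj, hl, hk] <;> simp
    simp only [Finset.mem_Icc] at hi hl hj hk
    rw [← hdiag i l j k hi.1 hil hl.2 hj.1 hjk hk.2]
    abel

theorem forall_isQMatrix_iff_qc {K : Type} [Field K] {q : K} {c : ℤ} :
    (∀ (A : Type) [Ring A] [Algebra K A] (x : ℕ → ℕ → A), IsQMatrix q m n x →
        qMinor q x S.I S.J * qMinor q x S.I' S.J' =
          (q ^ c) • (qMinor q x S.I' S.J' * qMinor q x S.I S.J)) ↔
      QC q S.I S.J S.I' S.J' c := by
  refine ⟨fun h A _ _ x hx => h A x (hx.isQMatrix m n), fun h A _ _ x hx => ?_⟩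
  have hy := h A _ (fullQ_truncate hx)
  have h₁ : qMinor q (truncate m n x) S.I S.J = qMinor q x S.I S.J :=
    qMinor_congr q fun i hi j hj => if_pos ⟨S.hIm hi, S.hJn hj⟩
  have h₂ : qMinor q (truncate m n x) S.I' S.J' = qMinor q x S.I' S.J' :=
    qMinor_congr q fun i hi j hj => if_pos ⟨S.hI'm hi, S.hJ'n hj⟩
  rwa [h₁, h₂] at hy

theorem zpow_ne_one_of_transcendental {K : Type} [Field K] [CharZero K] {q : K}
    (hq : Transcendental ℚ q) (c : ℤ) (hc : q ^ c = 1) : c = 0 := by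
  by_contra hne
  refine hq (IsAlgebraic.of_pow (Int.natAbs_pos.2 hne) ?_)
  have : q ^ c.natAbs = 1 := by
    rcases Int.natAbs_eq c with h | h <;> rw [h] at hc
    · rwa [zpow_natCast] at hc
    · rwa [zpow_neg, zpow_natCast, inv_eq_one] at hc
  rw [this]
  exact isAlgebraic_one

/-- If `I' ⊆ I` and the column sets are weakly separated, then the minors quasicommute. -/
theorem exists_qc_of_subset {K : Type} [Field K] {q : K} (hq : q ≠ 0) {I J I' J' : Finset ℕ}
    (hIJ : I.card = J.card) (hIJ' : I'.card = J'.card) (hI : I' ⊆ I)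
    (hJ : WeaklySeparated J J') : ∃ c, QC q I J I' J' c := by
  rcases hJ with hJ | hJ
  · exact qc_of_subset hq hIJ hI hJ
  · have hII : I' = I := Finset.eq_of_subset_of_card_le hI (by rw [hIJ, hIJ']; exact hJ.1)
    obtain ⟨c, hc⟩ := qc_of_subset hq hIJ' hII.ge hJ
    exact ⟨-c, hc.symm hq⟩

theorem exists_qc_of_weaklySeparated {K : Type} [Field K] {q : K} (hq : q ≠ 0)
    (h : WeaklySeparated S.I S.I' ∧ WeaklySeparated S.J S.J' ∧
        ((S.I' \ S.I = ∅ ∨ S.J' \ S.J = ∅) ∨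
          ((S.I' \ S.I).Nonempty ∧ (S.J' \ S.J).Nonempty ∧
            ((finsetLT (S.I \ S.I') (S.I' \ S.I) ∧ finsetLT (S.J' \ S.J) (S.J \ S.J')) ∨
             (finsetLT (S.I' \ S.I) (S.I \ S.I') ∧ finsetLT (S.J \ S.J') (S.J' \ S.J)))))) :
    ∃ c, QC q S.I S.J S.I' S.J' c := by
  obtain ⟨hI, hJ, (h | h) | ⟨-, -, ⟨h₁, h₂⟩ | ⟨h₁, h₂⟩⟩⟩ := h
  · exact exists_qc_of_subset hq S.hIJ S.hI'J' (Finset.sdiff_eq_empty_iff_subset.1 h) hJ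
  · obtain ⟨c, hc⟩ := exists_qc_of_subset hq S.hIJ.symm S.hI'J'.symm
      (Finset.sdiff_eq_empty_iff_subset.1 h) hI
    exact ⟨c, hc.transpose⟩
  · exact ⟨_, (qc_of_separated hq S.hI'J' S.hIJ h₁ h₂).symm hq⟩
  · exact ⟨_, qc_of_separated hq S.hIJ S.hI'J' h₁ h₂⟩

end Equivalences

end QuasiCommute

/-- Generalized Leclerc–Zelevinsky theorem: characterization of quasicommuting
(not necessarily flag) quantum minors. -/
theorem qMinor_quasicommute_iff
    {m n : ℕ} (K : Type) [Field K] [CharZero K]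
    (q : K) (hq : q ≠ 0) (htr : Transcendental ℚ q)
    (S : Cortege m n) (hcard : S.I'.card ≤ S.I.card) :
    ((∃ c : ℤ, ∀ (A : Type) [Ring A] [Algebra K A] (x : ℕ → ℕ → A),
        IsQMatrix q m n x →
        qMinor q x S.I S.J * qMinor q x S.I' S.J' =
          (q ^ c) • (qMinor q x S.I' S.J' * qMinor q x S.I S.J)) ↔
      (∃! M, IsFeasible S M)) ∧
    ((∃! M, IsFeasible S M) ↔
      (WeaklySeparated S.I S.I' ∧ WeaklySeparated S.J S.J' ∧
        ((S.I' \ S.I = ∅ ∨ S.J' \ S.J = ∅) ∨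
          ((S.I' \ S.I).Nonempty ∧ (S.J' \ S.J).Nonempty ∧
            ((finsetLT (S.I \ S.I') (S.I' \ S.I) ∧ finsetLT (S.J' \ S.J) (S.J \ S.J')) ∨
             (finsetLT (S.I' \ S.I) (S.I \ S.I') ∧ finsetLT (S.J \ S.J') (S.J' \ S.J))))))) := by
  have hii := QuasiCommute.existsUnique_isFeasible_iff_weaklySeparated S hcard
  simp only [QuasiCommute.forall_isQMatrix_iff_qc S]
  refine ⟨⟨?_, fun h => QuasiCommute.exists_qc_of_weaklySeparated S hq (hii.1 h)⟩, hii⟩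
  rintro ⟨c, hc⟩
  rw [QuasiCommute.existsUnique_isFeasible_iff]
  exact QuasiCommute.QC.not_alt4 hq (QuasiCommute.zpow_ne_one_of_transcendental htr)
    (QuasiCommute.subset_range_of_subset_Icc S.hIm S.hI'm)
    (QuasiCommute.subset_range_of_subset_Icc S.hJn S.hJ'n) S.hIJ S.hI'J' hc
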